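/- arXiv:2002.09520 — 3 statements merged into one kernel-verified Lean document; each statement's English description precedes it below -/
import Mathlib

section
/- (Margulis, 1983; restated as: SO(2,1) is not Milnor.) There exists a subgroup Γ of the group of affine transformations of ℝ³ such that: (i) the linear part of every element of Γ preserves the Lorentzian bilinear form B; (ii) Γ is isomorphic to the free group of rank 2 (in particular Γ is not virtually solvable); and (iii) the natural action of Γ on ℝ³ is properly discontinuous and free (no nontrivial element has a fixed point). -/
noncomputable section

/-- The vector space `ℝⁿ`. -/
abbrev V (n : ℕ) : Type := Fin n → ℝ

/-- The group of affine transformations of `ℝⁿ` (invertible affine self-maps). -/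
abbrev Aff (n : ℕ) : Type := V n ≃ᵃ[ℝ] V n

/-- An action (given by `act`) of `Γ` on a topological space `X` is properly discontinuous if
for all compact `K L ⊆ X`, only finitely many `γ` satisfy `act γ '' K ∩ L ≠ ∅`. -/
def ProperlyDisc {Γ : Type*} {X : Type*} [TopologicalSpace X] (act : Γ → X → X) : Prop :=
  ∀ K L : Set X, IsCompact K → IsCompact L → {γ : Γ | (act γ '' K ∩ L).Nonempty}.Finite

/-- The Lorentzian bilinear form on `ℝ³`. -/
def B3 (v w : Fin 3 → ℝ) : ℝ := v 0 * w 0 + v 1 * w 1 - v 2 * w 2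

/-- Letters of the free group of rank two: a generator together with a sign. -/
abbrev Letter : Type := Fin 2 × Bool

/-- The inverse letter. -/
def Letter.inv (s : Letter) : Letter := (s.1, !s.2)

/-- The sign of a letter. -/
def Letter.sign (s : Letter) : ℝ := if s.2 then 1 else -1

/-- The linear part of a letter: a boost with hyperbolic cosine `41 / 9` along one of the two
spacelike coordinate directions. -/
def boost (s : Letter) (v : V 3) : V 3 :=
  if s.1 = 0 then
    ![41 / 9 * v 0 + s.sign * (40 / 9) * v 2, v 1, s.sign * (40 / 9) * v 0 + 41 / 9 * v 2]
  else
    ![v 0, 41 / 9 * v 1 + s.sign * (40 / 9) * v 2, s.sign * (40 / 9) * v 1 + 41 / 9 * v 2]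

/-- The translational part of a letter; it is fixed by the boost. -/
def shift (s : Letter) : V 3 :=
  if s.1 = 0 then ![0, -s.sign, 0] else ![s.sign, 0, 0]

/-- The determinant of three vectors of `ℝ³`. -/
def det3 (x p q : V 3) : ℝ :=
  x 0 * (p 1 * q 2 - p 2 * q 1) - x 1 * (p 0 * q 2 - p 2 * q 0) + x 2 * (p 0 * q 1 - p 1 * q 0)

/-- The future null vectors in the attracting interval of a letter. -/
def attracting (s : Letter) : Set (V 3) :=
  {p | 0 < p 2 ∧ p 0 ^ 2 + p 1 ^ 2 = p 2 ^ 2 ∧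
    4 / 5 * p 2 ≤ s.sign * (if s.1 = 0 then p 0 else p 1)}

lemma boost_inv_boost (s : Letter) (v : V 3) : boost s.inv (boost s v) = v := by
  rcases s with ⟨i, b⟩
  fin_cases i <;> cases b <;> ext j <;> fin_cases j <;>
    simp [boost, Letter.inv, Letter.sign] <;> ring

lemma Letter.inv_inv (s : Letter) : s.inv.inv = s := by
  simp [Letter.inv]

lemma boost_boost_inv (s : Letter) (v : V 3) : boost s (boost s.inv v) = v := by
  simpa only [Letter.inv_inv] using boost_inv_boost s.inv v

lemma boost_add (s : Letter) (v w : V 3) : boost s (v + w) = boost s v + boost s w := by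
  rcases s with ⟨i, b⟩
  fin_cases i <;> ext j <;> fin_cases j <;> simp [boost] <;> ring

lemma boost_smul (s : Letter) (c : ℝ) (v : V 3) : boost s (c • v) = c • boost s v := by
  rcases s with ⟨i, b⟩
  fin_cases i <;> ext j <;> fin_cases j <;> simp [boost] <;> ring

lemma boost_shift (s : Letter) : boost s.inv (shift s) = shift s := by
  rcases s with ⟨i, b⟩
  fin_cases i <;> ext j <;> fin_cases j <;> simp [boost, shift, Letter.inv]

lemma shift_inv (s : Letter) : shift s.inv = -shift s := by
  rcases s with ⟨i, b⟩
  fin_cases i <;> cases b <;> ext j <;> fin_cases j <;> simp [shift, Letter.inv, Letter.sign]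

lemma B3_boost (s : Letter) (v w : V 3) : B3 (boost s v) (boost s w) = B3 v w := by
  rcases s with ⟨i, b⟩
  fin_cases i <;> cases b <;> simp [boost, B3, Letter.sign] <;> ring

lemma det3_boost (s : Letter) (x p q : V 3) :
    det3 (boost s x) (boost s p) (boost s q) = det3 x p q := by
  rcases s with ⟨i, b⟩
  fin_cases i <;> cases b <;> simp [boost, det3, Letter.sign] <;> ring

lemma det3_add (x y p q : V 3) : det3 (x + y) p q = det3 x p q + det3 y p q := by
  simp [det3]; ring

/-- The boost as a linear equivalence. -/
def boostEquiv (s : Letter) : V 3 ≃ₗ[ℝ] V 3 where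
  toFun := boost s
  invFun := boost s.inv
  left_inv := boost_inv_boost s
  right_inv := boost_boost_inv s
  map_add' := boost_add s
  map_smul' := boost_smul s

/-- The affine transformation attached to a letter. -/
def gen (s : Letter) : Aff 3 where
  toFun x := boost s x + shift s
  invFun x := boost s.inv x + shift s.inv
  left_inv x := by
    simp [boost_add, boost_inv_boost, boost_shift, shift_inv]
  right_inv x := by
    have h := boost_shift s.inv
    rw [Letter.inv_inv] at h
    change boost s (boost s.inv x + shift s.inv) + shift s = x
    rw [boost_add, boost_boost_inv, h, shift_inv, neg_add_cancel_right]
  linear := boostEquiv s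
  map_vadd' p v := by
    change boost s (v + p) + shift s = boost s v + (boost s p + shift s)
    rw [boost_add, add_assoc]

lemma gen_apply (s : Letter) (x : V 3) : gen s x = boost s x + shift s := rfl

lemma gen_linear (s : Letter) (v : V 3) : (gen s).linear v = boost s v := rfl

lemma gen_inv (s : Letter) : gen s.inv = (gen s)⁻¹ := by
  ext x
  rfl

lemma one_linear_apply (v : V 3) : (1 : Aff 3).linear v = v := rfl

lemma mul_apply_apply (g h : Aff 3) (x : V 3) : (g * h) x = g (h x) := rfl

lemma linear_mul (g h : Aff 3) (v : V 3) : (g * h).linear v = g.linear (h.linear v) := rfl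

/-- The affine transformation attached to a word. -/
def wordMap (L : List Letter) : Aff 3 := (L.map gen).prod

lemma wordMap_nil : wordMap [] = 1 := rfl

lemma wordMap_cons (s : Letter) (L : List Letter) : wordMap (s :: L) = gen s * wordMap L := by
  simp [wordMap]

lemma B3_wordMap (L : List Letter) (v w : V 3) :
    B3 ((wordMap L).linear v) ((wordMap L).linear w) = B3 v w := by
  induction L with
  | nil => rfl
  | cons s L ih => rw [wordMap_cons, linear_mul, linear_mul, gen_linear, gen_linear, B3_boost, ih]

/-- The attracting intervals of other letters lie away from that of a given letter. -/
lemma sign_mul_coord_le {s h : Letter} (hs : h ≠ s) {q : V 3} (hq : q ∈ attracting h) :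
    s.sign * (if s.1 = 0 then q 0 else q 1) ≤ 3 / 5 * q 2 := by
  obtain ⟨q2, qn, qc⟩ := hq
  rcases s with ⟨i, b⟩
  rcases h with ⟨j, c⟩
  fin_cases i <;> cases b <;> fin_cases j <;> cases c <;>
    simp [Letter.sign] at hs qc ⊢ <;> nlinarith

/-- Null vectors in the attracting intervals of distinct letters are separated in the coordinate
direction of the first letter. -/
lemma det3_shift_ge {s h : Letter} (hs : h ≠ s) {p q : V 3} (hp : p ∈ attracting s)
    (hq : q ∈ attracting h) : p 2 * q 2 / 5 ≤ det3 (shift s) p q := by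
  have hc := sign_mul_coord_le hs hq
  obtain ⟨p2, -, pc⟩ := hp
  obtain ⟨q2, -, -⟩ := hq
  have h1 := mul_le_mul_of_nonneg_right pc q2.le
  have h2 := mul_le_mul_of_nonneg_left hc p2.le
  rcases s with ⟨i, b⟩
  fin_cases i <;> simp [det3, shift] at h1 h2 ⊢ <;> linarith

lemma neg_B3_le {s h : Letter} {p q : V 3} (hp : p ∈ attracting s)
    (hq : q ∈ attracting h) : -B3 p q ≤ 2 * (p 2 * q 2) := by
  obtain ⟨p2, pn, -⟩ := hp
  obtain ⟨q2, qn, -⟩ := hq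
  have h : (p 0 * q 0 + p 1 * q 1) ^ 2 ≤ (p 2 * q 2) ^ 2 := by
    rw [mul_pow, ← pn, ← qn]
    nlinarith [sq_nonneg (p 0 * q 1 - p 1 * q 0)]
  have := (abs_le_of_sq_le_sq' h (by positivity)).1
  simp only [B3]
  linarith

lemma le_neg_B3 {s h : Letter} (hs : h ≠ s) {p q : V 3} (hp : p ∈ attracting s)
    (hq : q ∈ attracting h) : p 2 * q 2 / 50 ≤ -B3 p q := by
  have key := det3_shift_ge hs hp hq
  obtain ⟨p2, pn, -⟩ := hp
  obtain ⟨q2, qn, -⟩ := hq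
  have hpq : 0 < p 2 * q 2 := mul_pos p2 q2
  have e : 2 * (p 2 * q 2) * -B3 p q =
      (p 0 * q 2 - p 2 * q 0) ^ 2 + (p 1 * q 2 - p 2 * q 1) ^ 2 := by
    simp only [B3]
    linear_combination (-q 2 ^ 2) * pn - p 2 ^ 2 * qn
  have h1 : (p 2 * q 2 / 5) ^ 2 ≤ det3 (shift s) p q ^ 2 :=
    pow_le_pow_left₀ (by positivity) key 2
  have h2 : det3 (shift s) p q ^ 2 ≤
      (p 0 * q 2 - p 2 * q 0) ^ 2 + (p 1 * q 2 - p 2 * q 1) ^ 2 := by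
    rcases s with ⟨i, b⟩
    fin_cases i <;> cases b <;> simp [det3, shift, Letter.sign] <;>
      nlinarith [sq_nonneg (p 0 * q 2 - p 2 * q 0), sq_nonneg (p 1 * q 2 - p 2 * q 1)]
  have h3 : 2 * (p 2 * q 2) * (p 2 * q 2 / 50) ≤ 2 * (p 2 * q 2) * -B3 p q := by
    rw [e]; nlinarith
  exact le_of_mul_le_mul_left h3 (by positivity)

lemma abs_det3_le {s h : Letter} (hs : h ≠ s) {p q : V 3} (hp : p ∈ attracting s)
    (hq : q ∈ attracting h) (x : V 3) : |det3 x p q| ≤ 300 * ‖x‖ * -B3 p q := by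
  have key := le_neg_B3 hs hp hq
  obtain ⟨p2, pn, -⟩ := hp
  obtain ⟨q2, qn, -⟩ := hq
  have bound : ∀ r : V 3, 0 < r 2 → r 0 ^ 2 + r 1 ^ 2 = r 2 ^ 2 → ∀ i, |r i| ≤ r 2 := by
    intro r h0 h1 i
    fin_cases i
    · exact abs_le_of_sq_le_sq (by simp; nlinarith [sq_nonneg (r 1)]) h0.le
    · exact abs_le_of_sq_le_sq (by simp; nlinarith [sq_nonneg (r 0)]) h0.le
    · exact (abs_of_pos h0).le
  have hx : ∀ i, |x i| ≤ ‖x‖ := fun i => norm_le_pi_norm x i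
  have term : ∀ i j k, |x i * (p j * q k)| ≤ ‖x‖ * (p 2 * q 2) := by
    intro i j k
    rw [abs_mul, abs_mul]
    have := bound p p2 pn j
    have := bound q q2 qn k
    have := hx i
    gcongr
  have h6 : |det3 x p q| ≤ 6 * (‖x‖ * (p 2 * q 2)) := by
    have a1 := abs_le.1 (term 0 1 2)
    have a2 := abs_le.1 (term 0 2 1)
    have a3 := abs_le.1 (term 1 0 2)
    have a4 := abs_le.1 (term 1 2 0)
    have a5 := abs_le.1 (term 2 0 1)
    have a6 := abs_le.1 (term 2 1 0)
    simp only [det3]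
    rw [abs_le]
    constructor <;> linarith
  nlinarith [mul_le_mul_of_nonneg_left key (norm_nonneg x)]

lemma boost_mem_attracting {s h : Letter} (hs : h ≠ s.inv) {p : V 3} (hp : p ∈ attracting h) :
    boost s p ∈ attracting s := by
  have hc := sign_mul_coord_le hs hp
  obtain ⟨p2, pn, -⟩ := hp
  rcases s with ⟨i, b⟩
  fin_cases i <;> cases b <;>
    simp [boost, attracting, Letter.sign, Letter.inv] at hc ⊢ <;>
    refine ⟨by linarith, by linear_combination pn, by linarith⟩

/-- Consecutive letters of a reduced word are not inverse to each other. -/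
def Follows (a b : Letter) : Prop := b ≠ a.inv

lemma wordMap_expands (L : List Letter) (t : Letter) {p : V 3} (hp : p ∈ attracting t) :
    ∀ (h : Letter) (q : V 3), (h.inv :: (L ++ [t])).IsChain Follows → q ∈ attracting h →
      ∃ (k h' : Letter) (q' : V 3), h ≠ k ∧ h' ≠ t ∧ q' ∈ attracting h' ∧
        (wordMap L).linear q' = q ∧ (wordMap L).linear p ∈ attracting k ∧
        ∀ x, det3 x p q' + L.length / 10 * -B3 p q' ≤
          det3 (wordMap L x) ((wordMap L).linear p) q := by
  induction L with
  | nil =>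
    intro h q hc hq
    have hne : h ≠ t := by
      simpa [Follows, Letter.inv_inv, eq_comm] using hc
    exact ⟨t, h, q, hne, hne, hq, rfl, hp, fun x => by simp [wordMap_nil, one_linear_apply]⟩
  | cons s L ih =>
    intro h q hc hq
    rw [List.cons_append, List.isChain_cons_cons] at hc
    obtain ⟨hsh, hc⟩ := hc
    rw [Follows, Letter.inv_inv] at hsh
    have hq1 : boost s.inv q ∈ attracting s.inv :=
      boost_mem_attracting (by rw [Letter.inv_inv]; exact hsh.symm) hq
    obtain ⟨k, h', q', hk, hh', hq', hqq, hpk, hx⟩ :=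
      ih s.inv (boost s.inv q) (by rwa [Letter.inv_inv]) hq1
    have hps := boost_mem_attracting hk.symm hpk
    have hq0 : boost s ((wordMap L).linear q') = q := by rw [hqq, boost_boost_inv]
    refine ⟨s, h', q', hsh.symm, hh', hq', ?_, ?_, fun x => ?_⟩
    · rw [wordMap_cons, linear_mul, gen_linear, hq0]
    · rw [wordMap_cons, linear_mul, gen_linear]
      exact hps
    · have h1 := hx x
      have h2 := det3_shift_ge hsh.symm hps hq
      have h3 := neg_B3_le hps hq
      have h4 : B3 (boost s ((wordMap L).linear p)) q = B3 p q' := by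
        rw [← hq0, B3_boost, B3_wordMap]
      have h5 : det3 (boost s (wordMap L x)) (boost s ((wordMap L).linear p)) q =
          det3 (wordMap L x) ((wordMap L).linear p) (boost s.inv q) := by
        rw [← det3_boost s (wordMap L x), boost_boost_inv]
      rw [wordMap_cons, linear_mul, gen_linear, mul_apply_apply, gen_apply, det3_add, h5]
      rw [h4] at h3
      push_cast [List.length_cons]
      linarith

/-- The fixed null direction of a letter. -/
def axis (s : Letter) : V 3 := if s.1 = 0 then ![s.sign, 0, 1] else ![0, s.sign, 1]

lemma axis_mem (s : Letter) : axis s ∈ attracting s := by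
  rcases s with ⟨i, b⟩
  fin_cases i <;> cases b <;> simp [axis, attracting, Letter.sign] <;> norm_num

lemma Letter.ne_inv (s : Letter) : s ≠ s.inv := by
  rcases s with ⟨i, b⟩
  cases b <;> simp [Letter.inv]

/-- The length of a reduced word is controlled by the displacement of any point. -/
lemma length_le_of_isChain (L : List Letter) (hL : L.IsChain Follows) (x : V 3) :
    (L.length : ℝ) ≤ 3000 * (‖x‖ + ‖wordMap L x‖) := by
  rcases L with _ | ⟨s, N⟩
  · simp only [List.length_nil, Nat.cast_zero]
    positivity
  set L := s :: N with hLdef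
  have hne : L ≠ [] := List.cons_ne_nil s N
  set t := L.getLast hne
  have hc : (s.inv.inv :: (L ++ [t])).IsChain Follows := by
    rw [Letter.inv_inv, hLdef, List.cons_append, List.isChain_cons_cons, ← List.cons_append,
      ← hLdef, List.isChain_append]
    refine ⟨s.ne_inv, hL, List.isChain_singleton t, fun a ha b hb => ?_⟩
    rw [List.getLast?_eq_getLast_of_ne_nil hne] at ha
    simp only [Option.mem_def, Option.some.injEq, List.head?_cons] at ha hb
    rw [← ha, ← hb]
    exact t.ne_inv
  obtain ⟨k, h', q', hk, hh', hq', hqq, hpk, hx⟩ :=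
    wordMap_expands L t (axis_mem t) s.inv _ hc (axis_mem s.inv)
  have h1 := abs_le.1 (abs_det3_le hh' (axis_mem t) hq' x)
  have h2 := abs_le.1 (abs_det3_le hk hpk (axis_mem s.inv) (wordMap L x))
  have h3 := le_neg_B3 hh' (axis_mem t) hq'
  have h4 : 0 < -B3 (axis t) q' :=
    lt_of_lt_of_le (by have := mul_pos (axis_mem t).1 hq'.1; positivity) h3
  have h5 : B3 ((wordMap L).linear (axis t)) (axis s.inv) = B3 (axis t) q' := by
    rw [← hqq, B3_wordMap]
  rw [h5] at h2
  refine le_of_mul_le_mul_right ?_ h4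
  linarith [hx x]

/-- The homomorphism from the free group of rank two. -/
def freeHom : FreeGroup (Fin 2) →* Aff 3 := FreeGroup.lift fun i => gen (i, true)

lemma freeHom_eq_wordMap (w : FreeGroup (Fin 2)) : freeHom w = wordMap w.toWord := by
  conv_lhs => rw [← FreeGroup.mk_toWord (x := w)]
  rw [freeHom, FreeGroup.lift_mk, wordMap]
  congr 1
  refine List.map_congr_left fun s _ => ?_
  rcases s with ⟨i, b⟩
  cases b
  · exact (gen_inv (i, true)).symm
  · rfl

lemma length_toWord_le (w : FreeGroup (Fin 2)) (x : V 3) :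
    (w.toWord.length : ℝ) ≤ 3000 * (‖x‖ + ‖freeHom w x‖) := by
  rw [freeHom_eq_wordMap]
  refine length_le_of_isChain _ ?_ x
  refine List.IsChain.imp ?_ (FreeGroup.isReduced_toWord (x := w))
  rintro ⟨i, b⟩ ⟨j, c⟩ h e
  simp only [Letter.inv, Prod.mk.injEq] at e
  have := h e.1.symm
  simp [e.2] at this

lemma freeHom_injective : Function.Injective freeHom := by
  rw [injective_iff_map_eq_one]
  intro w hw
  have h := length_toWord_le w 0
  rw [hw] at h
  simpa using h

lemma finite_toWord_length_le (n : ℕ) : {w : FreeGroup (Fin 2) | w.toWord.length ≤ n}.Finite :=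
  (List.finite_length_le Letter n).preimage FreeGroup.toWord_injective.injOn

lemma freeHom_properlyDisc :
    ProperlyDisc (fun (γ : freeHom.range) (x : V 3) => (γ : Aff 3) x) := by
  intro K L hK hL
  obtain ⟨R, hR⟩ := (hK.union hL).isBounded.exists_norm_le
  have hfin := (finite_toWord_length_le ⌊3000 * (R + R)⌋₊).image freeHom
  refine Set.Finite.of_finite_image (f := Subtype.val) (hfin.subset ?_)
    Subtype.val_injective.injOn
  rintro _ ⟨⟨_, w, rfl⟩, ⟨_, ⟨x, hx, rfl⟩, hy⟩, rfl⟩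
  refine ⟨w, Nat.le_floor ?_, rfl⟩
  have h1 := hR x (Or.inl hx)
  have h2 := hR _ (Or.inr hy)
  have h3 := length_toWord_le w x
  simp only at h2
  linarith

lemma freeHom_apply_ne {w : FreeGroup (Fin 2)} (hw : w ≠ 1) (x : V 3) : freeHom w x ≠ x := by
  intro hx
  have hpow : ∀ n : ℕ, freeHom (w ^ n) x = x := by
    intro n
    induction n with
    | zero => simp
    | succ n ih => rw [pow_succ, map_mul, mul_apply_apply, hx, ih]
  have hinj : Function.Injective fun n : ℕ => w ^ n := IsMulTorsionFree.pow_right_injective hw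
  refine Set.infinite_range_of_injective hinj
    ((finite_toWord_length_le ⌊3000 * (‖x‖ + ‖x‖)⌋₊).subset ?_)
  rintro _ ⟨n, rfl⟩
  refine Nat.le_floor ?_
  have := length_toWord_le (w ^ n) x
  rwa [hpow n] at this

/-- (Margulis 1983.) There is a group of affine transformations of `ℝ³`, whose linear parts
all preserve the Lorentzian form, which is free of rank 2 and acts properly discontinuously
and freely on `ℝ³`. -/
theorem margulis_proper_affine_free_action :
    ∃ Γ : Subgroup (Aff 3),
      (∀ g ∈ Γ, ∀ v w : V 3, B3 ((g : Aff 3).linear v) ((g : Aff 3).linear w) = B3 v w) ∧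
      Nonempty (Γ ≃* FreeGroup (Fin 2)) ∧
      ProperlyDisc (fun (γ : Γ) (x : V 3) => (γ : Aff 3) x) ∧
      (∀ g ∈ Γ, g ≠ 1 → ∀ x : V 3, (g : Aff 3) x ≠ x) := by
  refine ⟨freeHom.range, ?_, ⟨(MonoidHom.ofInjective freeHom_injective).symm⟩,
    freeHom_properlyDisc, ?_⟩
  · rintro _ ⟨w, rfl⟩ v v'
    rw [freeHom_eq_wordMap]
    exact B3_wordMap _ v v'
  · rintro _ ⟨w, rfl⟩ hw x
    exact freeHom_apply_ne (fun h => hw (by rw [h, map_one])) x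
end
end

section
/- (Fried–Goldman.) Let Γ be a subgroup of the group of affine transformations of ℝ³ such that the linear part of every element of Γ preserves the Lorentzian bilinear form B, and suppose the natural action of Γ on ℝ³ is properly discontinuous. Then either Γ is virtually solvable, or the linear-part homomorphism L, sending each element of Γ to its linear part in GL(3,ℝ), is injective and its image is a discrete subgroup of GL(3,ℝ) (its subspace topology is discrete). -/
noncomputable section

/-- The linear part of an affine transformation, as a linear automorphism. -/
def linearPartHom (n : ℕ) : Aff n →* ((V n) ≃ₗ[ℝ] (V n)) where
  toFun g := g.linear
  map_one' := rfl
  map_mul' := fun _ _ => rfl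

/-- The linear-part homomorphism from the affine group of `ℝⁿ` to `GL(n, ℝ)`. -/
def LglHom (n : ℕ) : Aff n →* GL (Fin n) ℝ :=
  ((Units.map
    (LinearMap.toMatrixAlgEquiv' :
      ((V n) →ₗ[ℝ] (V n)) ≃ₐ[ℝ] Matrix (Fin n) (Fin n) ℝ).toRingEquiv.toMonoidHom).comp
    (LinearMap.GeneralLinearGroup.generalLinearEquiv ℝ (V n)).symm.toMonoidHom).comp
    (linearPartHom n)

open scoped commutatorElement

/-- The Lorentzian cross product on `ℝ³`. -/
def lorentzCross (v w : V 3) : V 3 :=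
  ![v 1 * w 2 - v 2 * w 1, v 2 * w 0 - v 0 * w 2, v 1 * w 0 - v 0 * w 1]

/-- The group of linear automorphisms of `ℝ³` preserving the Lorentzian form. -/
def lorentzGroup : Subgroup (V 3 ≃ₗ[ℝ] V 3) where
  carrier := {g | ∀ v w, B3 (g v) (g w) = B3 v w}
  one_mem' := fun _ _ => rfl
  mul_mem' := fun {a b} ha hb v w => (ha (b v) (b w)).trans (hb v w)
  inv_mem' := fun {a} ha v w => by
    have h := ha (a⁻¹ v) (a⁻¹ w)
    have e : ∀ u, a (a⁻¹ u) = u := fun u => a.apply_symm_apply u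
    rw [e, e] at h
    exact h.symm

theorem inv_apply_self' (g : V 3 ≃ₗ[ℝ] V 3) (v : V 3) : g⁻¹ (g v) = v := g.symm_apply_apply v

theorem apply_inv_self' (g : V 3 ≃ₗ[ℝ] V 3) (v : V 3) : g (g⁻¹ v) = v := g.apply_symm_apply v

theorem lorentzCross_smul_left (c : ℝ) (v w : V 3) :
    lorentzCross (c • v) w = c • lorentzCross v w := by
  ext i; fin_cases i <;> simp [lorentzCross] <;> ring

theorem lorentzCross_smul_right (c : ℝ) (v w : V 3) :
    lorentzCross v (c • w) = c • lorentzCross v w := by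
  ext i; fin_cases i <;> simp [lorentzCross] <;> ring

theorem lorentzCross_anticomm (v w : V 3) : lorentzCross v w = - lorentzCross w v := by
  ext i; fin_cases i <;> simp [lorentzCross] <;> ring

theorem lorentzCross_add_right (v w x : V 3) :
    lorentzCross v (w + x) = lorentzCross v w + lorentzCross v x := by
  ext i; fin_cases i <;> simp [lorentzCross] <;> ring

theorem exists_smul_of_lorentzCross_eq_zero {v w : V 3} (hv : v ≠ 0)
    (h : lorentzCross v w = 0) : ∃ c : ℝ, w = c • v := by
  have h0 := congrFun h 0
  have h1 := congrFun h 1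
  have h2 := congrFun h 2
  simp [lorentzCross] at h0 h1 h2
  obtain ⟨i, hi⟩ := Function.ne_iff.1 hv
  refine ⟨w i / v i, ?_⟩
  have hi' : v i ≠ 0 := hi
  ext j
  simp only [Pi.smul_apply, smul_eq_mul]
  rw [div_mul_eq_mul_div, eq_div_iff hi']
  fin_cases i <;> fin_cases j <;> simp <;> linarith

theorem lorentzCross_left_injective {v w : V 3} (h : ∀ x, lorentzCross v x = lorentzCross w x) :
    v = w := by
  have h0 := congrFun (h (Pi.single 0 1))
  have h1 := congrFun (h (Pi.single 1 1))
  have a := h0 1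
  have b := h0 2
  have c := h1 2
  simp [lorentzCross] at a b c
  ext i; fin_cases i <;> simp [*]

theorem B3_lorentzCross (x y z : V 3) :
    B3 (lorentzCross x y) z = Matrix.det (Matrix.of ![x, y, z]) := by
  simp [B3, lorentzCross, Matrix.det_fin_three]; ring

theorem B3_left_injective {v w : V 3} (h : ∀ x, B3 v x = B3 w x) : v = w := by
  have h0 := h (Pi.single 0 1)
  have h1 := h (Pi.single 1 1)
  have h2 := h (Pi.single 2 1)
  simp [B3] at h0 h1 h2
  ext i; fin_cases i <;> simp [*]

theorem det_of_map (g : V 3 ≃ₗ[ℝ] V 3) (x y z : V 3) :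
    Matrix.det (Matrix.of ![g x, g y, g z]) =
      LinearMap.det (g : V 3 →ₗ[ℝ] V 3) * Matrix.det (Matrix.of ![x, y, z]) := by
  have h := (Pi.basisFun ℝ (Fin 3)).det_comp (g : V 3 →ₗ[ℝ] V 3) ![x, y, z]
  rw [Pi.basisFun_det_apply, Pi.basisFun_det_apply] at h
  convert h using 3
  ext i j; fin_cases i <;> rfl

theorem exists_lorentzCross_map {g : V 3 ≃ₗ[ℝ] V 3} (hg : g ∈ lorentzGroup) :
    ∃ s : ℝ, s ≠ 0 ∧ ∀ x y, lorentzCross (g x) (g y) = s • g (lorentzCross x y) := by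
  refine ⟨LinearMap.det (g : V 3 →ₗ[ℝ] V 3), (LinearEquiv.isUnit_det' g).ne_zero, fun x y => ?_⟩
  refine B3_left_injective fun z => ?_
  have hz : z = g (g⁻¹ z) := (apply_inv_self' g z).symm
  rw [hz, B3_lorentzCross, det_of_map, ← B3_lorentzCross, ← hg]
  simp only [B3, Pi.smul_apply, smul_eq_mul]
  ring

/-- `a` is an axis vector of `g` when `g - g⁻¹` is the Lorentzian cross product with `a`. -/
def IsAxis (g : V 3 ≃ₗ[ℝ] V 3) (a : V 3) : Prop :=
  ∀ x, g x - g⁻¹ x = lorentzCross a x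

theorem exists_isAxis {g : V 3 ≃ₗ[ℝ] V 3} (hg : g ∈ lorentzGroup) : ∃ a, IsAxis g a := by
  have skew : ∀ x y, B3 (g x - g⁻¹ x) y = - B3 x (g y - g⁻¹ y) := by
    intro x y
    have h1 := hg x (g⁻¹ y)
    have h2 := hg (g⁻¹ x) y
    rw [apply_inv_self'] at h1 h2
    simp only [B3, Pi.sub_apply] at *
    linarith
  let k : V 3 →ₗ[ℝ] V 3 := (g : V 3 →ₗ[ℝ] V 3) - ((g⁻¹ : V 3 ≃ₗ[ℝ] V 3) : V 3 →ₗ[ℝ] V 3)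
  have hk : ∀ x, g x - g⁻¹ x = k x := fun x => rfl
  simp only [hk] at skew
  let e : Fin 3 → V 3 := fun i => Pi.single i 1
  refine ⟨![-(k (e 2) 1), k (e 2) 0, k (e 0) 1], fun x => ?_⟩
  have hx : x = x 0 • e 0 + x 1 • e 1 + x 2 • e 2 := by
    ext i; fin_cases i <;> simp [e]
  have h00 := skew (e 0) (e 0)
  have h01 := skew (e 0) (e 1)
  have h02 := skew (e 0) (e 2)
  have h11 := skew (e 1) (e 1)
  have h12 := skew (e 1) (e 2)
  have h22 := skew (e 2) (e 2)
  simp [B3, e] at h00 h01 h02 h11 h12 h22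
  rw [hk, congrArg k hx, map_add, map_add, map_smul, map_smul, map_smul]
  ext i
  fin_cases i <;> simp [lorentzCross, e]
  · have : k (Pi.single 0 1) 0 = 0 := by linarith
    rw [this, h01]; ring
  · have : k (Pi.single 1 1) 1 = 0 := by linarith
    rw [this]; ring
  · have : k (Pi.single 2 1) 2 = 0 := by linarith
    rw [this]; linear_combination x 0 * h02 + x 1 * h12

theorem IsAxis.unique {g : V 3 ≃ₗ[ℝ] V 3} {a b : V 3} (ha : IsAxis g a) (hb : IsAxis g b) :
    a = b :=
  lorentzCross_left_injective fun x => (ha x).symm.trans (hb x)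

theorem IsAxis.conj {g h : V 3 ≃ₗ[ℝ] V 3} {a : V 3} (ha : IsAxis g a) (hh : h ∈ lorentzGroup) :
    ∃ s : ℝ, s ≠ 0 ∧ IsAxis (h * g * h⁻¹) (s • h a) := by
  obtain ⟨s, hs, H⟩ := exists_lorentzCross_map hh
  refine ⟨s⁻¹, inv_ne_zero hs, fun x => ?_⟩
  have e : (h * g * h⁻¹)⁻¹ = h * g⁻¹ * h⁻¹ := by group
  rw [e]
  change h (g (h⁻¹ x)) - h (g⁻¹ (h⁻¹ x)) = _
  rw [← map_sub, ha]
  have h1 := H a (h⁻¹ x)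
  rw [apply_inv_self'] at h1
  rw [lorentzCross_smul_left, h1, smul_smul, inv_mul_cancel₀ hs, one_smul]

theorem IsAxis.exists_map_eq_smul {g : V 3 ≃ₗ[ℝ] V 3} {a : V 3} (ha : IsAxis g a)
    (hg : g ∈ lorentzGroup) : ∃ c : ℝ, g a = c • a := by
  obtain ⟨s, hs, H⟩ := ha.conj hg
  have e : g * g * g⁻¹ = g := by group
  rw [e] at H
  refine ⟨s⁻¹, ?_⟩
  rw [ha.unique H, map_smul, smul_smul, inv_mul_cancel₀ hs, one_smul]
  have := ha.unique H
  rw [← map_smul, ← this]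

theorem inv_map_eq_smul {g : V 3 ≃ₗ[ℝ] V 3} {a : V 3} {c : ℝ} (ha : a ≠ 0) (h : g a = c • a) :
    g⁻¹ a = c⁻¹ • a := by
  have hc : c ≠ 0 := by
    rintro rfl
    rw [zero_smul] at h
    exact ha ((LinearEquiv.map_eq_zero_iff g).1 h)
  have h1 := congrArg (g⁻¹ : V 3 ≃ₗ[ℝ] V 3) h
  rw [inv_apply_self', map_smul] at h1
  rw [eq_inv_smul_iff₀ hc]
  exact h1.symm

/-- A real eigenvector of a cross product operator with nonzero eigenvalue is null, and the
operator comes from a non-null vector. -/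
theorem B3_of_lorentzCross_eq_smul {a b : V 3} {c : ℝ} (hb : b ≠ 0) (hc : c ≠ 0)
    (h : lorentzCross a b = c • b) : B3 b b = 0 ∧ B3 a a ≠ 0 := by
  have h0 := congrFun h 0
  have h1 := congrFun h 1
  have h2 := congrFun h 2
  simp [lorentzCross] at h0 h1 h2
  have hbb : B3 b b = 0 := by
    refine (mul_eq_zero.1 (?_ : c * B3 b b = 0)).resolve_left hc
    simp only [B3]
    linear_combination (-b 0) * h0 - b 1 * h1 + b 2 * h2
  have hab : B3 a b = 0 := by
    refine (mul_eq_zero.1 (?_ : c * B3 a b = 0)).resolve_left hc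
    simp only [B3]
    linear_combination (-a 0) * h0 - a 1 * h1 + a 2 * h2
  refine ⟨hbb, fun haa => hb ?_⟩
  have key : ∀ i, c * c * b i = B3 a a * b i - B3 a b * a i := by
    intro i
    simp only [B3]
    fin_cases i <;> simp
    · linear_combination (-c) * h0 - a 1 * h2 + a 2 * h1
    · linear_combination (-c) * h1 + a 0 * h2 - a 2 * h0
    · linear_combination (-c) * h2 - a 1 * h0 + a 0 * h1
  ext i
  have := key i
  rw [haa, hab] at this
  simpa [hc] using this

theorem IsAxis.lorentzCross_eq_smul {g : V 3 ≃ₗ[ℝ] V 3} {a b : V 3} {c : ℝ} (ha : IsAxis g a)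
    (hb : b ≠ 0) (h : g b = c • b) : lorentzCross a b = (c - c⁻¹) • b := by
  rw [← ha, h, inv_map_eq_smul hb h, sub_smul]

/-- If an iterated commutator `⁅g, ⁅g, …, h⁆⁆` is trivial, `h` preserves the axis of `g`. -/
theorem exists_map_axis_eq_smul {g : V 3 ≃ₗ[ℝ] V 3} {a : V 3} (ha0 : a ≠ 0)
    (hg : g ∈ lorentzGroup) (ha : IsAxis g a) (u : ℕ → V 3 ≃ₗ[ℝ] V 3)
    (hu : ∀ k, u k ∈ lorentzGroup) (hrec : ∀ k, u (k + 1) = ⁅g, u k⁆) (k : ℕ) (hk : u k = 1) :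
    ∃ c : ℝ, u 0 a = c • a := by
  suffices ∀ k, (∃ c : ℝ, u k a = c • a) → ∃ c : ℝ, u 0 a = c • a from
    this k ⟨1, by rw [hk, one_smul]; rfl⟩
  clear hk k
  intro k
  induction k with
  | zero => exact id
  | succ k ih =>
    rintro ⟨c, hc⟩
    apply ih
    obtain ⟨s, hs, H⟩ := ha.conj (hu k)
    obtain ⟨r, hr⟩ := ha.exists_map_eq_smul hg
    have e : u k * g * (u k)⁻¹ = (u (k + 1))⁻¹ * g := by
      rw [hrec, commutatorElement_def]; group
    have hD : (u k * g * (u k)⁻¹) a = (r * c⁻¹) • a := by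
      rw [e]
      change (u (k + 1))⁻¹ (g a) = _
      rw [hr, map_smul, inv_map_eq_smul ha0 hc, smul_smul]
    have h1 := H.lorentzCross_eq_smul ha0 hD
    have h2 : r * c⁻¹ - (r * c⁻¹)⁻¹ = 0 := by
      by_contra hne
      obtain ⟨h3, h4⟩ := B3_of_lorentzCross_eq_smul ha0 hne h1
      apply h4
      have h5 := hu k a a
      rw [h3] at h5
      simp only [B3, Pi.smul_apply, smul_eq_mul] at h5 ⊢
      linear_combination s * s * h5
    rw [h2, zero_smul, lorentzCross_smul_left, lorentzCross_anticomm] at h1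
    refine exists_smul_of_lorentzCross_eq_zero ha0 ?_
    simpa [hs] using h1

theorem lorentzCross_axes_eq_zero {g h : V 3 ≃ₗ[ℝ] V 3} {a b : V 3} (ha0 : a ≠ 0) (hb0 : b ≠ 0)
    (ha : IsAxis g a) (hb : IsAxis h b) {c d : ℝ} (hc : h a = c • a) (hd : g b = d • b) :
    lorentzCross a b = 0 := by
  have h1 := ha.lorentzCross_eq_smul hb0 hd
  have h2 := hb.lorentzCross_eq_smul ha0 hc
  by_cases hd' : d - d⁻¹ = 0
  · rw [h1, hd', zero_smul]
  by_cases hc' : c - c⁻¹ = 0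
  · rw [lorentzCross_anticomm, h2, hc', zero_smul, neg_zero]
  · exact absurd (B3_of_lorentzCross_eq_smul hb0 hd' h1).1
      (B3_of_lorentzCross_eq_smul ha0 hc' h2).2

/-- For every nonzero `a`, some vector `w` is cyclic for the cross product with `a`. -/
theorem exists_cyclic_vector {a : V 3} (ha : a ≠ 0) :
    ∃ w, ∀ x, ∃ p q r : ℝ,
      x = p • w + q • lorentzCross a w + r • lorentzCross a (lorentzCross a w) := by
  obtain ⟨w, hw, haw⟩ : ∃ w, B3 w w = 0 ∧ B3 a w ≠ 0 := by
    by_contra! h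
    have h1 := h ![1, 0, 1] (by simp [B3])
    have h2 := h ![-1, 0, 1] (by simp [B3])
    have h3 := h ![0, 1, 1] (by simp [B3])
    simp [B3] at h1 h2 h3
    apply ha
    ext i; fin_cases i <;> simp <;> linarith
  let M := Matrix.of ![w, lorentzCross a w, lorentzCross a (lorentzCross a w)]
  have hM : M.det ≠ 0 := by
    have : M.det = -(B3 a w ^ 3 - B3 a w * B3 a a * B3 w w) := by
      simp only [M, Matrix.det_fin_three, B3, lorentzCross, Matrix.of_apply, Matrix.cons_val]
      ring
    rw [this, hw]
    simp [haw]
  refine ⟨w, fun x => ?_⟩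
  have hx : Matrix.vecMul (Matrix.vecMul x M⁻¹) M = x := by
    rw [Matrix.vecMul_vecMul, Matrix.nonsing_inv_mul _ (isUnit_iff_ne_zero.2 hM),
      Matrix.vecMul_one]
  refine ⟨Matrix.vecMul x M⁻¹ 0, Matrix.vecMul x M⁻¹ 1, Matrix.vecMul x M⁻¹ 2, ?_⟩
  conv_lhs => rw [← hx]
  generalize Matrix.vecMul x M⁻¹ = y
  ext i
  simp [Matrix.vecMul, dotProduct, Fin.sum_univ_three, M]

theorem commute_of_commute_lorentzCross {a : V 3} (ha : a ≠ 0) {g h : V 3 ≃ₗ[ℝ] V 3}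
    (hg : ∀ x, g (lorentzCross a x) = lorentzCross a (g x))
    (hh : ∀ x, h (lorentzCross a x) = lorentzCross a (h x)) : g * h = h * g := by
  obtain ⟨w, hw⟩ := exists_cyclic_vector ha
  have hww : g (h w) = h (g w) := by
    obtain ⟨p, q, r, e⟩ := hw (g w)
    obtain ⟨p', q', r', e'⟩ := hw (h w)
    rw [congrArg g e', congrArg h e]
    simp only [map_add, map_smul, hg, hh]
    rw [e, e']
    simp only [lorentzCross_add_right, lorentzCross_smul_right]
    module
  ext1 x
  change g (h x) = h (g x)
  obtain ⟨p, q, r, rfl⟩ := hw x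
  simp only [map_add, map_smul, hg, hh, hww]

/-- A linear automorphism of `ℝ³` as a continuous linear map. -/
def toCLM (g : V 3 ≃ₗ[ℝ] V 3) : V 3 →L[ℝ] V 3 :=
  LinearMap.toContinuousLinearMap (g : V 3 →ₗ[ℝ] V 3)

theorem toCLM_apply (g : V 3 ≃ₗ[ℝ] V 3) (x : V 3) : toCLM g x = g x := rfl

theorem toCLM_one : toCLM 1 = 1 := rfl

theorem toCLM_mul (g h : V 3 ≃ₗ[ℝ] V 3) : toCLM (g * h) = toCLM g * toCLM h := rfl

theorem toCLM_mul_inv (g : V 3 ≃ₗ[ℝ] V 3) : toCLM g * toCLM g⁻¹ = 1 := by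
  rw [← toCLM_mul, mul_inv_cancel, toCLM_one]

theorem toCLM_injective : Function.Injective toCLM := fun g h e => by
  ext1 x
  exact congrArg (fun f : V 3 →L[ℝ] V 3 => f x) e

theorem toCLM_commutator (g h : V 3 ≃ₗ[ℝ] V 3) :
    toCLM ⁅g, h⁆ = toCLM g * toCLM h * toCLM g⁻¹ * toCLM h⁻¹ := rfl

section NormedRing

variable {R : Type*} [NormedRing R] [NormOneClass R]

theorem norm_le_two_of_mul_eq_one {a a' : R} (h : a * a' = 1) (ha : ‖a - 1‖ ≤ 1 / 16) :
    ‖a'‖ ≤ 2 := by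
  have e : a' = 1 - (a - 1) * a' := by rw [sub_mul, h]; noncomm_ring
  have h1 : ‖a'‖ ≤ 1 + ‖a - 1‖ * ‖a'‖ := by
    calc ‖a'‖ = ‖1 - (a - 1) * a'‖ := by rw [← e]
      _ ≤ ‖(1 : R)‖ + ‖(a - 1) * a'‖ := norm_sub_le _ _
      _ ≤ 1 + ‖a - 1‖ * ‖a'‖ := by rw [norm_one]; gcongr; exact norm_mul_le _ _
  nlinarith [norm_nonneg a']

theorem norm_le_two {a : R} (ha : ‖a - 1‖ ≤ 1 / 16) : ‖a‖ ≤ 2 := by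
  have := norm_le_norm_sub_add a 1
  rw [norm_one] at this
  linarith

theorem norm_mul_mul_inv_sub_one_le {a a' b b' : R} (ha' : a * a' = 1) (hb' : b * b' = 1)
    (ha : ‖a - 1‖ ≤ 1 / 16) (hb : ‖b - 1‖ ≤ 1 / 16) :
    ‖a * b * a' * b' - 1‖ ≤ 1 / 2 * ‖b - 1‖ := by
  have e : a * b * a' * b' - 1 = ((a - 1) * (b - 1) - (b - 1) * (a - 1)) * a' * b' := by
    have h1 : b * a * a' * b' = 1 := by rw [mul_assoc b, ha', mul_one, hb']
    rw [show ((a - 1) * (b - 1) - (b - 1) * (a - 1)) = a * b - b * a by noncomm_ring, sub_mul,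
      sub_mul, h1]
  have h2 := norm_le_two_of_mul_eq_one ha' ha
  have h3 := norm_le_two_of_mul_eq_one hb' hb
  rw [e]
  calc _ ≤ ‖(a - 1) * (b - 1) - (b - 1) * (a - 1)‖ * ‖a'‖ * ‖b'‖ := norm_mul₃_le
    _ ≤ (‖a - 1‖ * ‖b - 1‖ + ‖b - 1‖ * ‖a - 1‖) * 2 * 2 := by
        gcongr
        exact (norm_sub_le _ _).trans (add_le_add (norm_mul_le _ _) (norm_mul_le _ _))
    _ ≤ 1 / 2 * ‖b - 1‖ := by nlinarith [norm_nonneg (b - 1)]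

end NormedRing

theorem IsAxis.ne_zero {g : V 3 ≃ₗ[ℝ] V 3} {a : V 3} (ha : IsAxis g a) (hg : g ≠ 1)
    (hn : ‖toCLM g - 1‖ ≤ 1 / 16) : a ≠ 0 := by
  rintro rfl
  apply hg
  apply toCLM_injective
  rw [toCLM_one, ← sub_eq_zero, ← norm_le_zero_iff]
  have hgg : ∀ x, g (g x) = x := fun x => by
    have h := ha (g x)
    rw [inv_apply_self', ← zero_smul ℝ (0 : V 3), lorentzCross_smul_left, zero_smul] at h
    exact sub_eq_zero.1 h
  have hm : ∀ (f₁ f₂ : V 3 →L[ℝ] V 3) (x : V 3), (f₁ * f₂) x = f₁ (f₂ x) := fun _ _ _ => rfl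
  have e : (2 : ℝ) • (toCLM g - 1) = -((toCLM g - 1) * (toCLM g - 1)) := by
    ext1 x
    simp only [smul_apply, neg_apply,
      hm, sub_apply,
      one_apply_eq_self, toCLM_apply, map_sub, hgg]
    module
  have h := congrArg norm e
  rw [norm_smul, norm_neg, Real.norm_ofNat] at h
  have := norm_mul_le (toCLM g - 1) (toCLM g - 1)
  nlinarith [norm_nonneg (toCLM g - 1)]

/-- The iterated commutators `⁅g, ⁅g, …, ⁅g, h⁆⁆⁆`. -/
def iterCommutator {G : Type*} [Group G] (g h : G) : ℕ → G
  | 0 => h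
  | k + 1 => ⁅g, iterCommutator g h k⁆

theorem linear_iterCommutator (g h : Aff 3) (k : ℕ) :
    linearPartHom 3 (iterCommutator g h k) =
      iterCommutator (linearPartHom 3 g) (linearPartHom 3 h) k := by
  induction k with
  | zero => rfl
  | succ k ih => rw [iterCommutator, map_commutatorElement, ih, iterCommutator]

theorem norm_iterCommutator_sub_one_le {g h : V 3 ≃ₗ[ℝ] V 3} (hg : ‖toCLM g - 1‖ ≤ 1 / 16)
    (hh : ‖toCLM h - 1‖ ≤ 1 / 16) (k : ℕ) :
    ‖toCLM (iterCommutator g h k) - 1‖ ≤ 1 / 16 * (1 / 2) ^ k := by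
  induction k with
  | zero => simpa [iterCommutator] using hh
  | succ k ih =>
    have h1 : ‖toCLM (iterCommutator g h k) - 1‖ ≤ 1 / 16 := by
      refine ih.trans ?_
      have : (1 / 2 : ℝ) ^ k ≤ 1 := pow_le_one₀ (by norm_num) (by norm_num)
      linarith
    have := norm_mul_mul_inv_sub_one_le (toCLM_mul_inv g) (toCLM_mul_inv (iterCommutator g h k))
      hg h1
    rw [iterCommutator, toCLM_commutator, pow_succ]
    linarith

theorem aff_apply (g : Aff 3) (x : V 3) : g x = toCLM (linearPartHom 3 g) x + g 0 := by
  have := g.toAffineMap.map_vadd 0 x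
  simp only [vadd_eq_add, add_zero] at this
  exact this

theorem norm_commutator_apply_zero_le {g h : Aff 3} (hg : ‖toCLM (linearPartHom 3 g) - 1‖ ≤ 1 / 16)
    (hh : ‖toCLM (linearPartHom 3 h) - 1‖ ≤ 1 / 16) :
    ‖⁅g, h⁆ 0‖ ≤ 9 * ‖g 0‖ + 1 / 2 * ‖h 0‖ := by
  set A := linearPartHom 3 g with hA
  set B := linearPartHom 3 h with hB
  have inv0 : ∀ f : Aff 3, f⁻¹ 0 = -(toCLM (linearPartHom 3 f)⁻¹ (f 0)) := by
    intro f
    have h1 := aff_apply f⁻¹ (f 0)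
    rw [map_inv] at h1
    rw [eq_neg_iff_add_eq_zero, add_comm, ← h1]
    exact f.symm_apply_apply 0
  have hm : ∀ (f₁ f₂ : V 3 →L[ℝ] V 3) (x : V 3), (f₁ * f₂) x = f₁ (f₂ x) := fun _ _ _ => rfl
  have e : ⁅g, h⁆ 0 = g 0 - (toCLM A * toCLM B * toCLM A⁻¹) (g 0)
      + ((toCLM A - 1) (h 0) - (toCLM A * toCLM B * toCLM A⁻¹ * toCLM B⁻¹ - 1) (h 0)) := by
    change g (h (g⁻¹ (h⁻¹ 0))) = _
    rw [aff_apply g, aff_apply h, aff_apply g⁻¹, inv0, inv0, map_inv, ← hA, ← hB]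
    simp only [hm, sub_apply,
      one_apply_eq_self, map_add, map_neg]
    abel
  have hc := norm_mul_mul_inv_sub_one_le (toCLM_mul_inv A) (toCLM_mul_inv B) hg hh
  have h1 := norm_le_two hg
  have h2 := norm_le_two hh
  have h3 := norm_le_two_of_mul_eq_one (toCLM_mul_inv A) hg
  have h4 : ‖toCLM A * toCLM B * toCLM A⁻¹‖ ≤ 8 :=
    calc _ ≤ ‖toCLM A‖ * ‖toCLM B‖ * ‖toCLM A⁻¹‖ := norm_mul₃_le
      _ ≤ 2 * 2 * 2 := by gcongr
      _ = 8 := by norm_num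
  have l1 := ContinuousLinearMap.le_of_opNorm_le _ h4 (g 0)
  have l2 := ContinuousLinearMap.le_of_opNorm_le _ hg (h 0)
  have l3 := ContinuousLinearMap.le_of_opNorm_le _ hc (h 0)
  rw [e]
  refine (norm_add_le _ _).trans ?_
  have n1 := norm_sub_le (g 0) ((toCLM A * toCLM B * toCLM A⁻¹) (g 0))
  have n2 := norm_sub_le ((toCLM A - 1) (h 0))
    ((toCLM A * toCLM B * toCLM A⁻¹ * toCLM B⁻¹ - 1) (h 0))
  nlinarith [norm_nonneg (h 0)]

theorem norm_iterCommutator_apply_zero_le {g h : Aff 3}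
    (hg : ‖toCLM (linearPartHom 3 g) - 1‖ ≤ 1 / 16)
    (hh : ‖toCLM (linearPartHom 3 h) - 1‖ ≤ 1 / 16) (k : ℕ) :
    ‖iterCommutator g h k 0‖ ≤ 18 * ‖g 0‖ + ‖h 0‖ := by
  induction k with
  | zero => exact le_add_of_nonneg_left (by positivity)
  | succ k ih =>
    have h1 : ‖toCLM (linearPartHom 3 (iterCommutator g h k)) - 1‖ ≤ 1 / 16 := by
      rw [linear_iterCommutator]
      refine (norm_iterCommutator_sub_one_le hg hh k).trans ?_
      have : (1 / 2 : ℝ) ^ k ≤ 1 := pow_le_one₀ (by norm_num) (by norm_num)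
      linarith
    have := norm_commutator_apply_zero_le hg h1
    rw [iterCommutator]
    linarith [norm_nonneg (h 0)]

theorem ProperlyDisc.finite_setOf_norm_apply_zero_le {Γ : Subgroup (Aff 3)}
    (hproper : ProperlyDisc (fun (γ : Γ) (x : V 3) => (γ : Aff 3) x)) (r : ℝ) :
    {γ : Γ | ‖(γ : Aff 3) 0‖ ≤ r}.Finite := by
  refine (hproper {0} (Metric.closedBall 0 r) isCompact_singleton
    (isCompact_closedBall 0 r)).subset fun γ hγ => ?_
  exact ⟨(γ : Aff 3) 0, ⟨0, rfl, rfl⟩, by simpa using hγ⟩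

theorem exists_linear_iterCommutator_eq_one {Γ : Subgroup (Aff 3)}
    (hproper : ProperlyDisc (fun (γ : Γ) (x : V 3) => (γ : Aff 3) x)) {g h : Aff 3}
    (hgΓ : g ∈ Γ) (hhΓ : h ∈ Γ) (hg : ‖toCLM (linearPartHom 3 g) - 1‖ ≤ 1 / 16)
    (hh : ‖toCLM (linearPartHom 3 h) - 1‖ ≤ 1 / 16) :
    ∃ k, iterCommutator (linearPartHom 3 g) (linearPartHom 3 h) k = 1 := by
  have hmem : ∀ k, iterCommutator g h k ∈ Γ := by
    intro k
    induction k with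
    | zero => exact hhΓ
    | succ k ih =>
      exact Γ.mul_mem (Γ.mul_mem (Γ.mul_mem hgΓ ih) (Γ.inv_mem hgΓ)) (Γ.inv_mem ih)
  let f : Γ → ℝ := fun γ => ‖toCLM (linearPartHom 3 γ) - 1‖
  have hfin := (hproper.finite_setOf_norm_apply_zero_le (18 * ‖g 0‖ + ‖h 0‖)).image f
  have hfin' := hfin.subset (Set.sdiff_subset (t := {0}))
  have hlim : Filter.Tendsto (fun k => f ⟨_, hmem k⟩) Filter.atTop (nhds 0) := by
    refine squeeze_zero (g := fun k => 1 / 16 * (1 / 2 : ℝ) ^ k) (fun k => norm_nonneg _)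
      (fun k => ?_) ?_
    · change ‖toCLM (linearPartHom 3 (iterCommutator g h k)) - 1‖ ≤ _
      rw [linear_iterCommutator]
      exact norm_iterCommutator_sub_one_le hg hh k
    · rw [show (0 : ℝ) = 1 / 16 * 0 by norm_num]
      exact (tendsto_pow_atTop_nhds_zero_of_lt_one (r := (1 / 2 : ℝ)) (by norm_num)
        (by norm_num)).const_mul (1 / 16)
  have hev := hlim.eventually (hfin'.isClosed.isOpen_compl.mem_nhds (by simp))
  obtain ⟨k, hk⟩ := hev.exists
  refine ⟨k, ?_⟩
  have hf : f ⟨_, hmem k⟩ = 0 := by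
    by_contra hne
    exact hk ⟨⟨_, norm_iterCommutator_apply_zero_le hg hh k, rfl⟩, hne⟩
  rw [← linear_iterCommutator]
  apply toCLM_injective
  rw [toCLM_one]
  exact sub_eq_zero.1 (norm_eq_zero.1 hf)

theorem lorentzCross_axes_eq_zero_of_properlyDisc {Γ : Subgroup (Aff 3)}
    (hB : ∀ g ∈ Γ, linearPartHom 3 g ∈ lorentzGroup)
    (hproper : ProperlyDisc (fun (γ : Γ) (x : V 3) => (γ : Aff 3) x)) {g h : Aff 3}
    (hgΓ : g ∈ Γ) (hhΓ : h ∈ Γ) (hg : ‖toCLM (linearPartHom 3 g) - 1‖ ≤ 1 / 16)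
    (hh : ‖toCLM (linearPartHom 3 h) - 1‖ ≤ 1 / 16) {a b : V 3} (ha0 : a ≠ 0) (hb0 : b ≠ 0)
    (ha : IsAxis (linearPartHom 3 g) a) (hb : IsAxis (linearPartHom 3 h) b) :
    lorentzCross a b = 0 := by
  have key : ∀ {g h : Aff 3}, g ∈ Γ → h ∈ Γ → ‖toCLM (linearPartHom 3 g) - 1‖ ≤ 1 / 16 →
      ‖toCLM (linearPartHom 3 h) - 1‖ ≤ 1 / 16 → ∀ {a : V 3}, a ≠ 0 →
      IsAxis (linearPartHom 3 g) a → ∃ c : ℝ, linearPartHom 3 h a = c • a := by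
    intro g h hgΓ hhΓ hg hh a ha0 ha
    obtain ⟨k, hk⟩ := exists_linear_iterCommutator_eq_one hproper hgΓ hhΓ hg hh
    refine exists_map_axis_eq_smul ha0 (hB g hgΓ) ha
      (iterCommutator (linearPartHom 3 g) (linearPartHom 3 h)) (fun k => ?_) (fun _ => rfl) k hk
    induction k with
    | zero => exact hB h hhΓ
    | succ k ih =>
      have hg' := hB g hgΓ
      exact mul_mem (mul_mem (mul_mem hg' ih) (inv_mem hg')) (inv_mem ih)
  obtain ⟨c, hc⟩ := key hgΓ hhΓ hg hh ha0 ha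
  obtain ⟨d, hd⟩ := key hhΓ hgΓ hh hg hb0 hb
  exact lorentzCross_axes_eq_zero ha0 hb0 ha hb hc hd

/-- The linear automorphisms commuting with the Lorentzian cross product with `a`. -/
def crossCentralizer (a : V 3) : Subgroup (V 3 ≃ₗ[ℝ] V 3) where
  carrier := {g | ∀ x, g (lorentzCross a x) = lorentzCross a (g x)}
  one_mem' := fun _ => rfl
  mul_mem' := fun {g h} hg hh x => (congrArg g (hh x)).trans (hg (h x))
  inv_mem' := fun {g} hg x => by
    have h := hg (g⁻¹ x)
    rw [apply_inv_self'] at h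
    exact (congrArg (g⁻¹ : V 3 ≃ₗ[ℝ] V 3) h).symm.trans (inv_apply_self' g _)

theorem exists_map_lorentzCross_eq_smul {g : V 3 ≃ₗ[ℝ] V 3} (hg : g ∈ lorentzGroup) {a : V 3}
    (ha : a ≠ 0) {c : ℝ} (hc : g a = c • a) :
    ∃ m : ℝ, m ≠ 0 ∧ ∀ x, g (lorentzCross a x) = m • lorentzCross a (g x) := by
  have hc0 : c ≠ 0 := by
    rintro rfl
    rw [zero_smul] at hc
    exact ha ((LinearEquiv.map_eq_zero_iff g).1 hc)
  obtain ⟨s, hs, H⟩ := exists_lorentzCross_map hg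
  refine ⟨s⁻¹ * c, mul_ne_zero (inv_ne_zero hs) hc0, fun x => ?_⟩
  rw [mul_smul, ← lorentzCross_smul_left, ← hc, H, smul_smul, inv_mul_cancel₀ hs, one_smul]

theorem commutator_mem_crossCentralizer {g h : V 3 ≃ₗ[ℝ] V 3} (hg : g ∈ lorentzGroup)
    (hh : h ∈ lorentzGroup) {a : V 3} (ha : a ≠ 0) {c d : ℝ} (hc : g a = c • a)
    (hd : h a = d • a) : ⁅g, h⁆ ∈ crossCentralizer a := by
  obtain ⟨m, hm, H⟩ := exists_map_lorentzCross_eq_smul hg ha hc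
  obtain ⟨n, hn, K⟩ := exists_map_lorentzCross_eq_smul hh ha hd
  have key : ∀ x, (g * h) (lorentzCross a x) = (n * m) • lorentzCross a ((g * h) x) := fun x => by
    change g (h _) = _ • lorentzCross a (g (h x))
    rw [K, map_smul, H, smul_smul]
  have key' : ∀ x, (h * g) (lorentzCross a x) = (n * m) • lorentzCross a ((h * g) x) := fun x => by
    change h (g _) = _ • lorentzCross a (h (g x))
    rw [H, map_smul, K, smul_smul, mul_comm]
  have e : ⁅g, h⁆ = (g * h) * (h * g)⁻¹ := by rw [commutatorElement_def]; group
  intro x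
  rw [e]
  change (g * h) ((h * g)⁻¹ _) = lorentzCross a ((g * h) ((h * g)⁻¹ x))
  obtain ⟨y, rfl⟩ : ∃ y, x = (h * g) y := ⟨(h * g)⁻¹ x, (apply_inv_self' _ _).symm⟩
  have h1 : lorentzCross a ((h * g) y) = (h * g) ((n * m)⁻¹ • lorentzCross a y) := by
    rw [map_smul, key', smul_smul, inv_mul_cancel₀ (mul_ne_zero hn hm), one_smul]
  rw [h1, inv_apply_self', inv_apply_self', map_smul, key, smul_smul,
    inv_mul_cancel₀ (mul_ne_zero hn hm), one_smul]

/-- A group acting on `ℝ³` by Lorentzian isometries that preserve a line is solvable as soon as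
the kernel of the action is commutative. -/
theorem isSolvable_of_invariant_line {G : Type*} [Group G] (φ : G →* (V 3 ≃ₗ[ℝ] V 3))
    (hφ : ∀ g, φ g ∈ lorentzGroup) (hker : ∀ g h, φ g = 1 → φ h = 1 → g * h = h * g)
    {a : V 3} (ha : a ≠ 0) (hline : ∀ g, ∃ c : ℝ, φ g a = c • a) : Group.IsSolvable G := by
  have h1 : derivedSeries G 1 ≤ (crossCentralizer a).comap φ := by
    rw [derivedSeries_succ, Subgroup.commutator_le]
    intro g _ h _
    obtain ⟨c, hc⟩ := hline g
    obtain ⟨d, hd⟩ := hline h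
    rw [Subgroup.mem_comap, map_commutatorElement]
    exact commutator_mem_crossCentralizer (hφ g) (hφ h) ha hc hd
  have h2 : derivedSeries G 2 ≤ φ.ker := by
    rw [derivedSeries_succ, Subgroup.commutator_le]
    intro g hg h hh
    rw [MonoidHom.mem_ker, map_commutatorElement, commutatorElement_eq_one_iff_mul_comm]
    exact commute_of_commute_lorentzCross ha (h1 hg) (h1 hh)
  have h3 : derivedSeries G 3 = ⊥ := by
    rw [derivedSeries_succ, eq_bot_iff, Subgroup.commutator_le]
    intro g hg h hh
    rw [Subgroup.mem_bot, commutatorElement_eq_one_iff_mul_comm]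
    exact hker g h (h2 hg) (h2 hh)
  exact ⟨⟨3, h3⟩⟩

theorem apply_of_linear_eq_one {g : Aff 3} (hg : linearPartHom 3 g = 1) (x : V 3) :
    g x = x + g 0 := by
  rw [aff_apply, hg]; rfl

theorem mul_comm_of_linear_eq_one {g h : Aff 3} (hg : linearPartHom 3 g = 1)
    (hh : linearPartHom 3 h = 1) : g * h = h * g := by
  ext1 x
  change g (h x) = h (g x)
  rw [apply_of_linear_eq_one hg (h x), apply_of_linear_eq_one hh x,
    apply_of_linear_eq_one hh (g x), apply_of_linear_eq_one hg x]
  abel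

/-- The translation vectors of the pure translations in `Γ`. -/
def translationLattice (Γ : Subgroup (Aff 3)) : AddSubgroup (V 3) where
  carrier := {t | ∃ σ ∈ Γ, linearPartHom 3 σ = 1 ∧ σ 0 = t}
  zero_mem' := ⟨1, Γ.one_mem, map_one _, rfl⟩
  add_mem' := by
    rintro _ _ ⟨σ, hσ, h1, rfl⟩ ⟨τ, hτ, h2, rfl⟩
    refine ⟨τ * σ, Γ.mul_mem hτ hσ, by rw [map_mul, h1, h2, one_mul], ?_⟩
    exact apply_of_linear_eq_one h2 (σ 0)
  neg_mem' := by
    rintro _ ⟨σ, hσ, h1, rfl⟩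
    have h2 : linearPartHom 3 σ⁻¹ = 1 := by rw [map_inv, h1, inv_one]
    refine ⟨σ⁻¹, Γ.inv_mem hσ, h2, ?_⟩
    have h3 := apply_of_linear_eq_one h2 (σ 0)
    rw [show σ⁻¹ (σ 0) = 0 from σ.symm_apply_apply 0] at h3
    exact (neg_eq_of_add_eq_zero_right h3.symm).symm

theorem linear_apply_mem_translationLattice {Γ : Subgroup (Aff 3)} {g : Aff 3} (hg : g ∈ Γ)
    {t : V 3} (ht : t ∈ translationLattice Γ) : linearPartHom 3 g t ∈ translationLattice Γ := by
  obtain ⟨σ, hσ, h1, rfl⟩ := ht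
  refine ⟨g * σ * g⁻¹, Γ.mul_mem (Γ.mul_mem hg hσ) (Γ.inv_mem hg), ?_, ?_⟩
  · rw [map_mul, map_mul, h1, mul_one, map_inv, mul_inv_cancel]
  · change g (σ (g⁻¹ 0)) = _
    have h2 : g (g⁻¹ 0) = 0 := g.apply_symm_apply 0
    rw [aff_apply] at h2
    rw [apply_of_linear_eq_one h1, aff_apply, map_add, add_right_comm, h2, zero_add]
    rfl

/-- The linear part homomorphism restricted to `Γ`. -/
def linearPartRestrict (Γ : Subgroup (Aff 3)) : Γ →* (V 3 ≃ₗ[ℝ] V 3) :=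
  (linearPartHom 3).comp Γ.subtype

theorem finiteIndex_ker_of_det_ne_zero {Γ : Subgroup (Aff 3)}
    (hproper : ProperlyDisc (fun (γ : Γ) (x : V 3) => (γ : Aff 3) x)) {t : Fin 3 → V 3}
    (ht : ∀ i, t i ∈ translationLattice Γ) (hdet : (Matrix.of t).det ≠ 0) :
    (linearPartRestrict Γ).ker.FiniteIndex := by
  have hfin := hproper.finite_setOf_norm_apply_zero_le (∑ i, ‖t i‖)
  have : Finite {γ : Γ | ‖(γ : Aff 3) 0‖ ≤ ∑ i, ‖t i‖} := hfin
  have hsurj : Function.Surjective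
      (fun γ : {γ : Γ | ‖(γ : Aff 3) 0‖ ≤ ∑ i, ‖t i‖} =>
        (QuotientGroup.mk (γ : Γ) : Γ ⧸ (linearPartRestrict Γ).ker)) := by
    intro q
    obtain ⟨γ, rfl⟩ := QuotientGroup.mk_surjective q
    obtain ⟨y, hy⟩ : ∃ y : Fin 3 → ℝ, ∑ i, y i • t i = (γ : Aff 3) 0 := by
      refine ⟨Matrix.vecMul ((γ : Aff 3) 0) (Matrix.of t)⁻¹, ?_⟩
      have hx : Matrix.vecMul (Matrix.vecMul ((γ : Aff 3) 0) (Matrix.of t)⁻¹) (Matrix.of t)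
          = (γ : Aff 3) 0 := by
        rw [Matrix.vecMul_vecMul, Matrix.nonsing_inv_mul _ (isUnit_iff_ne_zero.2 hdet),
          Matrix.vecMul_one]
      rw [Matrix.vecMul_eq_sum] at hx
      exact hx
    have hmem : -∑ i, ⌊y i⌋ • t i ∈ translationLattice Γ :=
      neg_mem (sum_mem fun i _ => zsmul_mem (ht i) _)
    obtain ⟨σ, hσ, h1, h2⟩ := hmem
    refine ⟨⟨⟨σ, hσ⟩ * γ, ?_⟩, ?_⟩
    · change ‖σ ((γ : Aff 3) 0)‖ ≤ _
      have e : σ ((γ : Aff 3) 0) = ∑ i, Int.fract (y i) • t i := by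
        rw [apply_of_linear_eq_one h1, h2, ← hy, ← sub_eq_add_neg, ← Finset.sum_sub_distrib]
        refine Finset.sum_congr rfl fun i _ => ?_
        rw [← Int.cast_smul_eq_zsmul ℝ, ← sub_smul, Int.self_sub_floor]
      rw [e]
      refine (norm_sum_le _ _).trans (Finset.sum_le_sum fun i _ => ?_)
      rw [norm_smul, Real.norm_of_nonneg (Int.fract_nonneg _)]
      exact mul_le_of_le_one_left (norm_nonneg _) (Int.fract_lt_one _).le
    · refine QuotientGroup.eq.2 ?_
      rw [MonoidHom.mem_ker, map_mul, map_inv, map_mul]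
      have : linearPartRestrict Γ ⟨σ, hσ⟩ = 1 := h1
      rw [this, one_mul, inv_mul_cancel]
  have : Finite (Γ ⧸ (linearPartRestrict Γ).ker) := Finite.of_surjective _ hsurj
  exact Subgroup.finiteIndex_of_finite_quotient

theorem lorentzCross_lorentzCross_eq_zero {a u w : V 3} (hu : B3 a u = 0) (hw : B3 a w = 0) :
    lorentzCross a (lorentzCross u w) = 0 := by
  simp only [B3] at hu hw
  ext i
  fin_cases i <;> simp [lorentzCross]
  · linear_combination w 0 * hu - u 0 * hw
  · linear_combination w 1 * hu - u 1 * hw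
  · linear_combination w 2 * hu - u 2 * hw

theorem isSolvable_of_invariant_axis {Γ : Subgroup (Aff 3)}
    (hB : ∀ g ∈ Γ, linearPartHom 3 g ∈ lorentzGroup) {a : V 3} (ha : a ≠ 0)
    (hline : ∀ g ∈ Γ, ∃ c : ℝ, linearPartHom 3 g a = c • a) : Group.IsSolvable Γ :=
  isSolvable_of_invariant_line (linearPartRestrict Γ) (fun g => hB g g.2)
    (fun _ _ hg hh => Subtype.ext (mul_comm_of_linear_eq_one hg hh)) ha (fun g => hline g g.2)

theorem exists_finiteIndex_isSolvable_of_translation {Γ : Subgroup (Aff 3)}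
    (hB : ∀ g ∈ Γ, linearPartHom 3 g ∈ lorentzGroup)
    (hproper : ProperlyDisc (fun (γ : Γ) (x : V 3) => (γ : Aff 3) x)) {t : V 3}
    (ht : t ∈ translationLattice Γ) (ht0 : t ≠ 0) :
    ∃ H : Subgroup Γ, H.FiniteIndex ∧ Group.IsSolvable H := by
  by_cases h3 : ∃ t : Fin 3 → V 3, (∀ i, t i ∈ translationLattice Γ) ∧ (Matrix.of t).det ≠ 0
  · obtain ⟨t, ht, hdet⟩ := h3
    refine ⟨(linearPartRestrict Γ).ker, finiteIndex_ker_of_det_ne_zero hproper ht hdet, ?_⟩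
    exact Group.isSolvable_of_comm fun g h =>
      Subtype.ext (Subtype.ext (mul_comm_of_linear_eq_one g.2 h.2))
  suffices Group.IsSolvable Γ from
    ⟨⊤, inferInstance, inferInstanceAs (Group.IsSolvable (⊤ : Subgroup Γ))⟩
  by_cases h2 : ∃ u ∈ translationLattice Γ, ∃ w ∈ translationLattice Γ, lorentzCross u w ≠ 0
  · obtain ⟨u, hu, w, hw, huw⟩ := h2
    have hperp : ∀ x ∈ translationLattice Γ, B3 (lorentzCross u w) x = 0 := by
      intro x hx
      by_contra hne
      refine h3 ⟨![u, w, x], fun i => ?_, by rwa [← B3_lorentzCross]⟩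
      fin_cases i <;> assumption
    refine isSolvable_of_invariant_axis hB huw fun g hg => ?_
    obtain ⟨s, hs, H⟩ := exists_lorentzCross_map (hB g hg)
    have h1 := lorentzCross_lorentzCross_eq_zero
      (hperp _ (linear_apply_mem_translationLattice hg hu))
      (hperp _ (linear_apply_mem_translationLattice hg hw))
    rw [H, lorentzCross_smul_right] at h1
    exact exists_smul_of_lorentzCross_eq_zero huw ((smul_eq_zero.1 h1).resolve_left hs)
  · push Not at h2
    exact isSolvable_of_invariant_axis hB ht0 fun g hg =>
      exists_smul_of_lorentzCross_eq_zero ht0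
        (h2 _ ht _ (linear_apply_mem_translationLattice hg ht))

theorem isSolvable_of_small_linear_parts {Γ : Subgroup (Aff 3)}
    (hB : ∀ g ∈ Γ, linearPartHom 3 g ∈ lorentzGroup)
    (hproper : ProperlyDisc (fun (γ : Γ) (x : V 3) => (γ : Aff 3) x))
    (hsmall : ∀ ε > 0, ∃ g ∈ Γ, ‖toCLM (linearPartHom 3 g) - 1‖ < ε ∧ linearPartHom 3 g ≠ 1) :
    Group.IsSolvable Γ := by
  obtain ⟨f, hf, hfn, hf1⟩ := hsmall (1 / 16) (by norm_num)
  obtain ⟨a, ha⟩ := exists_isAxis (hB f hf)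
  have ha0 := ha.ne_zero hf1 hfn.le
  refine isSolvable_of_invariant_axis hB ha0 fun g hg => ?_
  set A := linearPartHom 3 g with hA
  set C := ‖toCLM A‖ * ‖toCLM A⁻¹‖ with hC
  have hC0 : 0 ≤ C := by positivity
  obtain ⟨h, hh, hhn, hh1⟩ := hsmall (1 / 16 / (C + 1)) (by positivity)
  have hhn' : ‖toCLM (linearPartHom 3 h) - 1‖ ≤ 1 / 16 :=
    hhn.le.trans (div_le_self (by norm_num) (by linarith))
  obtain ⟨b, hb⟩ := exists_isAxis (hB h hh)
  have hb0 := hb.ne_zero hh1 hhn'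
  obtain ⟨s, hs, hconj⟩ := hb.conj (hB g hg)
  have hconjn : ‖toCLM (linearPartHom 3 (g * h * g⁻¹)) - 1‖ ≤ 1 / 16 := by
    have e : toCLM (linearPartHom 3 (g * h * g⁻¹)) - 1 =
        toCLM A * (toCLM (linearPartHom 3 h) - 1) * toCLM A⁻¹ := by
      rw [map_mul, map_mul, map_inv, toCLM_mul, toCLM_mul, mul_sub, sub_mul, mul_one,
        toCLM_mul_inv]
    rw [e]
    calc _ ≤ ‖toCLM A‖ * ‖toCLM (linearPartHom 3 h) - 1‖ * ‖toCLM A⁻¹‖ := norm_mul₃_le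
      _ = C * ‖toCLM (linearPartHom 3 h) - 1‖ := by rw [hC]; ring
      _ ≤ (C + 1) * (1 / 16 / (C + 1)) := by gcongr; linarith
      _ = 1 / 16 := mul_div_cancel₀ _ (by positivity)
  have hsb : s • A b ≠ 0 := smul_ne_zero hs fun h0 => hb0 ((LinearEquiv.map_eq_zero_iff A).1 h0)
  have h1 := lorentzCross_axes_eq_zero_of_properlyDisc hB hproper hf hh hfn.le hhn' ha0 hb0 ha hb
  have h2 := lorentzCross_axes_eq_zero_of_properlyDisc hB hproper hf
    (Γ.mul_mem (Γ.mul_mem hg hh) (Γ.inv_mem hg)) hfn.le hconjn ha0 hsb ha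
    (by rw [map_mul, map_mul, map_inv]; exact hconj)
  obtain ⟨c, rfl⟩ := exists_smul_of_lorentzCross_eq_zero ha0 h1
  have hc : c ≠ 0 := by rintro rfl; simp at hb0
  rw [map_smul, lorentzCross_smul_right, lorentzCross_smul_right, smul_eq_zero, smul_eq_zero] at h2
  exact exists_smul_of_lorentzCross_eq_zero ha0 ((h2.resolve_left hs).resolve_left hc)

/-- Matrices acting on `ℝ³` as continuous linear maps. -/
def matrixToCLM : Matrix (Fin 3) (Fin 3) ℝ →ₗ[ℝ] (V 3 →L[ℝ] V 3) :=
  LinearMap.toContinuousLinearMap.toLinearMap ∘ₗ Matrix.toLin'.toLinearMap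

theorem matrixToCLM_LglHom (g : Aff 3) :
    matrixToCLM (LglHom 3 g : Matrix (Fin 3) (Fin 3) ℝ) = toCLM (linearPartHom 3 g) := by
  ext1 x
  change Matrix.toLin' (LinearMap.toMatrix' ((linearPartHom 3 g : V 3 ≃ₗ[ℝ] V 3) : V 3 →ₗ[ℝ] V 3)) x
    = _
  rw [Matrix.toLin'_toMatrix']
  rfl

theorem LglHom_eq_one_iff (g : Aff 3) : LglHom 3 g = 1 ↔ linearPartHom 3 g = 1 := by
  constructor
  · intro h
    apply toCLM_injective
    have h1 := matrixToCLM_LglHom 1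
    rw [map_one, map_one] at h1
    rw [← matrixToCLM_LglHom, h, h1]
  · intro h
    rw [LglHom, MonoidHom.comp_apply, h, map_one]

theorem discreteTopology_map_LglHom {Γ : Subgroup (Aff 3)} {ε : ℝ} (hε : 0 < ε)
    (h : ∀ g ∈ Γ, ‖toCLM (linearPartHom 3 g) - 1‖ < ε → linearPartHom 3 g = 1) :
    DiscreteTopology (Γ.map (LglHom 3)) := by
  apply discreteTopology_of_isOpen_singleton_one
  have hcont : Continuous fun x : Γ.map (LglHom 3) =>
      matrixToCLM ((x : GL (Fin 3) ℝ) : Matrix (Fin 3) (Fin 3) ℝ) :=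
    matrixToCLM.continuous_of_finiteDimensional.comp
      (Units.continuous_val.comp continuous_subtype_val)
  convert (Metric.isOpen_ball (x := (1 : V 3 →L[ℝ] V 3)) (ε := ε)).preimage hcont
  ext ⟨x, g, hg, rfl⟩
  rw [Set.mem_singleton_iff, Set.mem_preimage, Metric.mem_ball, matrixToCLM_LglHom,
    dist_eq_norm, Subtype.ext_iff, Subgroup.coe_one, LglHom_eq_one_iff]
  refine ⟨fun h1 => ?_, h g hg⟩
  rw [h1, toCLM_one, sub_self, norm_zero]
  exact hε

/-- (Fried–Goldman.) A group of Lorentzian affine isometries of `ℝ³` acting properly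
discontinuously is either virtually solvable, or maps isomorphically under the linear-part
homomorphism onto a discrete subgroup of `GL(3,ℝ)`. -/
theorem friedGoldman_dichotomy
    (Γ : Subgroup (Aff 3))
    (hB : ∀ g ∈ Γ, ∀ v w : V 3, B3 ((g : Aff 3).linear v) ((g : Aff 3).linear w) = B3 v w)
    (hproper : ProperlyDisc (fun (γ : Γ) (x : V 3) => (γ : Aff 3) x)) :
    (∃ H : Subgroup Γ, H.FiniteIndex ∧ IsSolvable H) ∨
    (Function.Injective (fun γ : Γ => LglHom 3 (γ : Aff 3)) ∧
      DiscreteTopology (Γ.map (LglHom 3))) := by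
  have hB' : ∀ g ∈ Γ, linearPartHom 3 g ∈ lorentzGroup := hB
  by_cases hsmall : ∀ ε > 0, ∃ g ∈ Γ, ‖toCLM (linearPartHom 3 g) - 1‖ < ε ∧ linearPartHom 3 g ≠ 1
  · have := isSolvable_of_small_linear_parts hB' hproper hsmall
    exact Or.inl ⟨⊤, inferInstance, inferInstanceAs (Group.IsSolvable (⊤ : Subgroup Γ))⟩
  push Not at hsmall
  obtain ⟨ε, hε, hsmall⟩ := hsmall
  by_cases hinj : Function.Injective (fun γ : Γ => LglHom 3 (γ : Aff 3))
  · exact Or.inr ⟨hinj, discreteTopology_map_LglHom hε hsmall⟩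
  left
  have hker : ∃ σ ∈ Γ, linearPartHom 3 σ = 1 ∧ σ ≠ 1 := by
    by_contra! hker
    apply hinj
    change Function.Injective ((LglHom 3).comp Γ.subtype)
    rw [injective_iff_map_eq_one]
    intro γ hγ
    exact Subtype.ext (hker γ γ.2 ((LglHom_eq_one_iff _).1 hγ))
  obtain ⟨σ, hσ, h1, hne⟩ := hker
  refine exists_finiteIndex_isSolvable_of_translation hB' hproper (t := σ 0) ⟨σ, hσ, h1, rfl⟩ ?_
  intro h0
  apply hne
  ext1 x
  rw [apply_of_linear_eq_one h1, h0, add_zero]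
  rfl
end
end

section
/- (Smilga, adjoint representation; family of instances for G = SL(n,ℝ).) For every n ≥ 2, there exists a group Γ of affine transformations of the vector space sl(n,ℝ) of traceless n×n real matrices such that: (i) every element of Γ has the form X ↦ g X g⁻¹ + Y for some g ∈ SL(n,ℝ) and some traceless matrix Y (i.e. the linear part lies in the image of the adjoint representation of SL(n,ℝ)); (ii) Γ is isomorphic to the free group of rank 2; and (iii) the action of Γ on sl(n,ℝ) is properly discontinuous. -/
noncomputable section

/-- `sl(n,ℝ)`: the space of traceless `n × n` real matrices, as a submodule of the matrices. -/
def sl (n : ℕ) : Submodule ℝ (Matrix (Fin n) (Fin n) ℝ) :=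
  LinearMap.ker (Matrix.traceLinearMap (Fin n) ℝ ℝ)

/-- The group of affine transformations of the vector space `sl(n,ℝ)`. -/
abbrev AffSl (n : ℕ) : Type := (sl n) ≃ᵃ[ℝ] (sl n)

/-- The standard area form on the plane. -/
def planeArea (x y : ℝ × ℝ) : ℝ := x.1 * y.2 - x.2 * y.1

/-- A `2 × 2` matrix acting on the plane. -/
def planeAct (B : Matrix (Fin 2) (Fin 2) ℝ) (x : ℝ × ℝ) : ℝ × ℝ :=
  (B 0 0 * x.1 + B 0 1 * x.2, B 1 0 * x.1 + B 1 1 * x.2)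

/-- The trace pairing of `B` with the traceless matrix whose eigenvectors for the eigenvalues
`-1` and `1` are `x` and `y`. -/
def geodesicPairing (B : Matrix (Fin 2) (Fin 2) ℝ) (x y : ℝ × ℝ) : ℝ :=
  (planeArea x (planeAct B y) + planeArea y (planeAct B x)) / planeArea x y

/-- The linear parts of the Schottky generators. -/
def schottkyMat : Fin 2 → Matrix (Fin 2) (Fin 2) ℝ :=
  ![!![3, 0; 0, 1 / 3], !![5 / 3, 4 / 3; 4 / 3, 5 / 3]]

/-- The inverses of the linear parts of the Schottky generators. -/
def schottkyInv : Fin 2 → Matrix (Fin 2) (Fin 2) ℝ :=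
  ![!![1 / 3, 0; 0, 3], !![5 / 3, -4 / 3; -4 / 3, 5 / 3]]

/-- The translation parts of the Schottky generators. -/
def schottkyTrans : Fin 2 → Matrix (Fin 2) (Fin 2) ℝ :=
  ![!![1, 0; 0, -1], !![0, 1; 1, 0]]

/-- The linear part attached to a letter of the free group. -/
def letterMat (l : Fin 2 × Bool) : Matrix (Fin 2) (Fin 2) ℝ :=
  cond l.2 (schottkyMat l.1) (schottkyInv l.1)

/-- The translation part attached to a letter of the free group. -/
def letterTrans (l : Fin 2 × Bool) : Matrix (Fin 2) (Fin 2) ℝ :=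
  cond l.2 (schottkyTrans l.1) (-schottkyTrans l.1)

/-- The inverse letter. -/
def letterInv (l : Fin 2 × Bool) : Fin 2 × Bool := (l.1, !l.2)

/-- The attracting direction of a letter. -/
def letterAxis (l : Fin 2 × Bool) : ℝ × ℝ :=
  cond l.2 (![(1, 0), (1, 1)] l.1) (![(0, 1), (-1, 1)] l.1)

/-- The ping-pong cone of a letter. -/
def InCone (l : Fin 2 × Bool) (x : ℝ × ℝ) : Prop :=
  0 < x.1 ^ 2 + x.2 ^ 2 ∧
    9 * planeArea (letterAxis l) x ^ 2 ≤
      ((letterAxis l).1 * x.1 + (letterAxis l).2 * x.2) ^ 2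

theorem planeArea_act_letterMat (l : Fin 2 × Bool) (x y : ℝ × ℝ) :
    planeArea (planeAct (letterMat l) x) (planeAct (letterMat l) y) = planeArea x y := by
  obtain ⟨i, b⟩ := l
  fin_cases i <;> cases b <;>
    simp [planeArea, planeAct, letterMat, schottkyMat, schottkyInv] <;> ring

theorem planeAct_letterMat_letterInv (l : Fin 2 × Bool) (x : ℝ × ℝ) :
    planeAct (letterMat l) (planeAct (letterMat (letterInv l)) x) = x := by
  obtain ⟨i, b⟩ := l
  obtain ⟨x₁, x₂⟩ := x
  fin_cases i <;> cases b <;>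
    simp [planeAct, letterMat, letterInv, schottkyMat, schottkyInv] <;>
    (try constructor) <;> ring

theorem planeAct_mul (A B : Matrix (Fin 2) (Fin 2) ℝ) (x : ℝ × ℝ) :
    planeAct (A * B) x = planeAct A (planeAct B x) := by
  simp only [planeAct, Matrix.mul_apply, Fin.sum_univ_two, Prod.mk.injEq]
  constructor <;> ring

theorem geodesicPairing_add (A B : Matrix (Fin 2) (Fin 2) ℝ) (x y : ℝ × ℝ) :
    geodesicPairing (A + B) x y = geodesicPairing A x y + geodesicPairing B x y := by
  simp only [geodesicPairing, planeArea, planeAct, Matrix.add_apply, ← add_div]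
  congr 1
  ring

/-- Equivariance of the pairing. -/
theorem geodesicPairing_conj (l : Fin 2 × Bool) (B : Matrix (Fin 2) (Fin 2) ℝ) (x y : ℝ × ℝ) :
    geodesicPairing (letterMat l * B * letterMat (letterInv l)) (planeAct (letterMat l) x)
      (planeAct (letterMat l) y) = geodesicPairing B x y := by
  have h : ∀ z, planeAct (letterMat (letterInv l)) (planeAct (letterMat l) z) = z := fun z => by
    have := planeAct_letterMat_letterInv (letterInv l) z
    rwa [show letterInv (letterInv l) = l by simp [letterInv]] at this
  simp only [geodesicPairing, planeAct_mul, h, planeArea_act_letterMat]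

/-- Ping-pong. -/
theorem InCone.act {l m : Fin 2 × Bool} (h : m ≠ letterInv l) {x : ℝ × ℝ} (hx : InCone m x) :
    InCone l (planeAct (letterMat l) x) := by
  obtain ⟨i, b⟩ := l
  obtain ⟨j, c⟩ := m
  obtain ⟨h₀, h₁⟩ := hx
  fin_cases i <;> fin_cases j <;> cases b <;> cases c <;>
    simp [InCone, planeArea, planeAct, letterMat, letterInv, schottkyMat, schottkyInv,
      letterAxis] at h h₁ ⊢ <;>
    constructor <;> nlinarith

theorem InCone.exists_coord {l : Fin 2 × Bool} {x : ℝ × ℝ} (hx : InCone l x) :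
    ∃ r s : ℝ, r ≠ 0 ∧ -(1 / 3) ≤ s ∧ s ≤ 1 / 3 ∧
      x.1 = r * ((letterAxis l).1 - s * (letterAxis l).2) ∧
      x.2 = r * ((letterAxis l).2 + s * (letterAxis l).1) := by
  obtain ⟨h₀, h₁⟩ := hx
  set e := letterAxis l with he
  have hee : 0 < e.1 ^ 2 + e.2 ^ 2 := by
    obtain ⟨i, b⟩ := l
    fin_cases i <;> cases b <;> simp [he, letterAxis]
  have hid : (e.1 * x.1 + e.2 * x.2) ^ 2 + planeArea e x ^ 2 =
      (e.1 ^ 2 + e.2 ^ 2) * (x.1 ^ 2 + x.2 ^ 2) := by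
    simp only [planeArea]; ring
  have hd : e.1 * x.1 + e.2 * x.2 ≠ 0 := by
    intro h
    rw [h] at h₁ hid
    nlinarith [mul_pos hee h₀]
  have frame : ∀ a b u v : ℝ, a * u + b * v ≠ 0 → a ^ 2 + b ^ 2 ≠ 0 →
      u = (a * u + b * v) / (a ^ 2 + b ^ 2) * (a - (a * v - b * u) / (a * u + b * v) * b) ∧
      v = (a * u + b * v) / (a ^ 2 + b ^ 2) * (b + (a * v - b * u) / (a * u + b * v) * a) := by
    intro a b u v hd hn
    generalize hD : a * u + b * v = D at hd
    generalize hN : a ^ 2 + b ^ 2 = N at hn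
    constructor <;> field_simp <;> rw [← hD, ← hN] <;> ring
  have hs := abs_le.1 ((sq_le_sq₀ (abs_nonneg _) (by norm_num : (0 : ℝ) ≤ 1 / 3)).1
    (show |planeArea e x / (e.1 * x.1 + e.2 * x.2)| ^ 2 ≤ (1 / 3) ^ 2 by
      rw [sq_abs, div_pow, div_le_iff₀ (by positivity)]
      linarith))
  refine ⟨(e.1 * x.1 + e.2 * x.2) / (e.1 ^ 2 + e.2 ^ 2),
    planeArea e x / (e.1 * x.1 + e.2 * x.2), by positivity, hs.1, hs.2,
    (frame _ _ _ _ hd hee.ne').1, (frame _ _ _ _ hd hee.ne').2⟩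

theorem corner_nonneg {s t : ℝ} (hs : -(1 / 3) ≤ s) (hs' : s ≤ 1 / 3) (ht : -(1 / 3) ≤ t)
    (ht' : t ≤ 1 / 3) : 0 ≤ (s + 1 / 3) * (t + 1 / 3) ∧ 0 ≤ (1 / 3 - s) * (t + 1 / 3) ∧
      0 ≤ (s + 1 / 3) * (1 / 3 - t) ∧ 0 ≤ (1 / 3 - s) * (1 / 3 - t) :=
  ⟨mul_nonneg (by linarith) (by linarith), mul_nonneg (by linarith) (by linarith),
    mul_nonneg (by linarith) (by linarith), mul_nonneg (by linarith) (by linarith)⟩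

theorem letterAxis_coord_le (l : Fin 2 × Bool) {s : ℝ} (hs : -(1 / 3) ≤ s) (hs' : s ≤ 1 / 3) :
    |(letterAxis l).1 - s * (letterAxis l).2| + |(letterAxis l).2 + s * (letterAxis l).1| ≤ 2 := by
  obtain ⟨i, b⟩ := l
  have h : ∀ a b : ℝ, a + b ≤ 2 → a - b ≤ 2 → b - a ≤ 2 → -a - b ≤ 2 → |a| + |b| ≤ 2 := by
    intro a b _ _ _ _
    rcases abs_cases a with h | h <;> rcases abs_cases b with h' | h' <;> linarith
  apply h <;> fin_cases i <;> cases b <;> norm_num [letterAxis] <;> linarith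

theorem InCone.mul_le_planeArea {l m : Fin 2 × Bool} (h : l ≠ m) {x y : ℝ × ℝ}
    (hx : InCone l x) (hy : InCone m y) :
    0 < |planeArea x y| ∧
    (|x.1| + |x.2|) * (|y.1| + |y.2|) ≤ 18 * |planeArea x y| := by
  obtain ⟨r, s, hr, hs, hs', hx₁, hx₂⟩ := hx.exists_coord
  obtain ⟨r', t, hr', ht, ht', hy₁, hy₂⟩ := hy.exists_coord
  obtain ⟨c₁, c₂, c₃, c₄⟩ := corner_nonneg hs hs' ht ht'
  have area : planeArea x y = r * r' *
      planeArea ((letterAxis l).1 - s * (letterAxis l).2, (letterAxis l).2 + s * (letterAxis l).1)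
      ((letterAxis m).1 - t * (letterAxis m).2, (letterAxis m).2 + t * (letterAxis m).1) := by
    simp only [planeArea, hx₁, hx₂, hy₁, hy₂]; ring
  have low : 2 / 9 ≤ |planeArea
      ((letterAxis l).1 - s * (letterAxis l).2, (letterAxis l).2 + s * (letterAxis l).1)
      ((letterAxis m).1 - t * (letterAxis m).2, (letterAxis m).2 + t * (letterAxis m).1)| := by
    obtain ⟨i, b⟩ := l
    obtain ⟨j, c⟩ := m
    fin_cases i <;> fin_cases j <;> cases b <;> cases c <;>
      simp [planeArea, letterAxis] at h ⊢ <;> rw [le_abs] <;>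
      first
      | (left; linarith)
      | (right; linarith)
  have hrr : 0 < |r * r'| := by positivity
  rw [area, abs_mul]
  refine ⟨by positivity, ?_⟩
  rw [hx₁, hx₂, hy₁, hy₂]
  simp only [abs_mul r, abs_mul r', ← mul_add]
  have := mul_le_mul (letterAxis_coord_le l hs hs') (letterAxis_coord_le m ht ht') (by positivity) (by norm_num)
  rw [abs_mul] at hrr
  nlinarith [mul_le_mul_of_nonneg_left this hrr.le, mul_le_mul_of_nonneg_left low hrr.le]

theorem abs_geodesicPairing_le {l m : Fin 2 × Bool} (h : l ≠ m) {x y : ℝ × ℝ}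
    (hx : InCone l x) (hy : InCone m y) {B : Matrix (Fin 2) (Fin 2) ℝ} {M : ℝ}
    (hB : ∀ i j, |B i j| ≤ M) : |geodesicPairing B x y| ≤ 36 * M := by
  obtain ⟨h₀, h₁⟩ := hx.mul_le_planeArea h hy
  have hM : 0 ≤ M := (abs_nonneg _).trans (hB 0 0)
  have key : ∀ x y : ℝ × ℝ, |planeArea x (planeAct B y)| ≤
      M * ((|x.1| + |x.2|) * (|y.1| + |y.2|)) := by
    intro x y
    have e : ∀ i (a : ℝ), |a * (B i 0 * y.1 + B i 1 * y.2)| ≤ M * (|a| * (|y.1| + |y.2|)) := by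
      intro i a
      have := abs_add_le (B i 0 * y.1) (B i 1 * y.2)
      rw [abs_mul, abs_mul] at this
      rw [abs_mul]
      have h1 := mul_le_mul_of_nonneg_right (hB i 0) (abs_nonneg y.1)
      have h2 := mul_le_mul_of_nonneg_right (hB i 1) (abs_nonneg y.2)
      have := mul_le_mul_of_nonneg_left (this.trans (add_le_add h1 h2)) (abs_nonneg a)
      linarith
    have := abs_sub (x.1 * (B 1 0 * y.1 + B 1 1 * y.2)) (x.2 * (B 0 0 * y.1 + B 0 1 * y.2))
    simp only [planeArea, planeAct]
    linarith [e 1 x.1, e 0 x.2]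
  rw [geodesicPairing, abs_div, div_le_iff₀ h₀]
  have := abs_add_le (planeArea x (planeAct B y)) (planeArea y (planeAct B x))
  have := key x y
  have := key y x
  nlinarith [mul_le_mul_of_nonneg_left h₁ hM]

/-- Each letter translates uniformly along geodesics entering its cone. -/
theorem le_geodesicPairing_letterTrans {k l : Fin 2 × Bool} (h : k ≠ l) {x y : ℝ × ℝ}
    (hx : InCone k x) (hy : InCone l y) : 1 / 5 ≤ geodesicPairing (letterTrans l) x y := by
  have h₀ := (hx.mul_le_planeArea h hy).1
  obtain ⟨r, s, hr, hs, hs', hx₁, hx₂⟩ := hx.exists_coord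
  obtain ⟨r', t, hr', ht, ht', hy₁, hy₂⟩ := hy.exists_coord
  obtain ⟨c₁, c₂, c₃, c₄⟩ := corner_nonneg hs hs' ht ht'
  set X : ℝ × ℝ := ((letterAxis k).1 - s * (letterAxis k).2,
    (letterAxis k).2 + s * (letterAxis k).1) with hX
  set Y : ℝ × ℝ := ((letterAxis l).1 - t * (letterAxis l).2,
    (letterAxis l).2 + t * (letterAxis l).1) with hY
  have e : geodesicPairing (letterTrans l) x y = geodesicPairing (letterTrans l) X Y := by
    have hrr : r * r' ≠ 0 := mul_ne_zero hr hr'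
    rw [geodesicPairing, geodesicPairing, ← mul_div_mul_left _ (planeArea X Y) hrr]
    simp only [planeArea, planeAct, hx₁, hx₂, hy₁, hy₂, hX, hY]
    congr 1 <;> ring
  rw [e, geodesicPairing]
  obtain ⟨i, b⟩ := k
  obtain ⟨j, c⟩ := l
  fin_cases i <;> fin_cases j <;> cases b <;> cases c <;>
    simp [planeArea, planeAct, letterAxis, letterTrans, schottkyTrans, hX, hY] at h ⊢ <;>
    first
    | (rw [le_div_iff₀ (by linarith)]; linarith)
    | (rw [le_div_iff_of_neg (by linarith)]; linarith)

/-- A reduced word increases the pairing with a suitable geodesic linearly in its length. -/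
theorem exists_geodesicPairing_growth {V : Type*} (T : Fin 2 × Bool → V → V)
    (β : V → Matrix (Fin 2) (Fin 2) ℝ)
    (hT : ∀ l v, β (T l v) = letterMat l * β v * letterMat (letterInv l) + letterTrans l)
    {m : Fin 2 × Bool} {y : ℝ × ℝ} (hy : InCone m y) (L : List (Fin 2 × Bool)) :
    ∀ {k : Fin 2 × Bool} {x : ℝ × ℝ}, InCone k x →
      FreeGroup.IsReduced (letterInv k :: (L ++ [m])) →
      ∃ k' x' m' y', k' ≠ m ∧ InCone k' x' ∧ k ≠ m' ∧ InCone m' y' ∧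
        ∀ v, geodesicPairing (β v) x' y + L.length / 5 ≤
          geodesicPairing (β (L.foldr T v)) x y' := by
  have ne_of {k l : Fin 2 × Bool} (h : (letterInv k).1 = l.1 → (letterInv k).2 = l.2) :
      k ≠ l := by
    rintro rfl
    simp [letterInv] at h
  induction L with
  | nil =>
    intro k x hx h
    have hkm : k ≠ m := ne_of (FreeGroup.isReduced_cons_cons.1 h).1
    exact ⟨k, x, m, y, hkm, hx, hkm, hy, fun v => by simp⟩
  | cons l L ih =>
    intro k x hx h
    obtain ⟨h₁, h₂⟩ := FreeGroup.isReduced_cons_cons.1 h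
    have hkl := ne_of h₁
    have hll : letterInv (letterInv l) = l := by simp [letterInv]
    have hx' : InCone (letterInv l) (planeAct (letterMat (letterInv l)) x) :=
      hx.act (by rwa [hll])
    obtain ⟨k', x', m', y', hk', hcx, hm', hcy, hv⟩ := ih hx' (by rwa [hll])
    have hy' : InCone l (planeAct (letterMat l) y') := hcy.act hm'.symm
    refine ⟨k', x', l, planeAct (letterMat l) y', hk', hcx, hkl, hy', fun v => ?_⟩
    have h₃ := geodesicPairing_conj l (β (L.foldr T v)) (planeAct (letterMat (letterInv l)) x) y'
    rw [planeAct_letterMat_letterInv] at h₃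
    rw [List.foldr_cons, hT, geodesicPairing_add, h₃]
    have := le_geodesicPairing_letterTrans hkl hx hy'
    have := hv v
    push_cast [List.length_cons]
    linarith

theorem inCone_letterAxis (l : Fin 2 × Bool) : InCone l (letterAxis l) := by
  obtain ⟨i, b⟩ := l
  fin_cases i <;> cases b <;> norm_num [InCone, letterAxis, planeArea]

theorem isReduced_append_getLast {α : Type*} {L : List (α × Bool)} (h : FreeGroup.IsReduced L)
    (hL : L ≠ []) : FreeGroup.IsReduced (L ++ [L.getLast hL]) := by
  have h' := List.dropLast_append_getLast hL
  have := FreeGroup.IsReduced.append_overlap (L₁ := L.dropLast) (L₂ := [L.getLast hL])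
    (L₃ := [L.getLast hL]) (by rwa [h'])
    (FreeGroup.isReduced_cons_cons.2 ⟨fun _ => rfl, FreeGroup.IsReduced.singleton⟩) (by simp)
  rwa [h'] at this

/-- A reduced word moving a matrix of size `M` to a matrix of size `M'` has length bounded in
terms of `M` and `M'`. -/
theorem length_le_of_isReduced {V : Type*} (T : Fin 2 × Bool → V → V)
    (β : V → Matrix (Fin 2) (Fin 2) ℝ)
    (hT : ∀ l v, β (T l v) = letterMat l * β v * letterMat (letterInv l) + letterTrans l)
    {L : List (Fin 2 × Bool)} (hL : FreeGroup.IsReduced L) {v : V} {M M' : ℝ}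
    (hM : ∀ i j, |β v i j| ≤ M) (hM' : ∀ i j, |β (L.foldr T v) i j| ≤ M') :
    (L.length : ℝ) ≤ 180 * (M + M') := by
  have h₀ : 0 ≤ M := (abs_nonneg _).trans (hM 0 0)
  have h₀' : 0 ≤ M' := (abs_nonneg _).trans (hM' 0 0)
  rcases L with _ | ⟨l, L⟩
  · simp only [List.length_nil, Nat.cast_zero]
    positivity
  have hne : l :: L ≠ [] := by simp
  have hll : letterInv (letterInv l) = l := by simp [letterInv]
  have hred := isReduced_append_getLast hL hne
  obtain ⟨k', x', m', y', hk, hx, hm, hy, h⟩ := exists_geodesicPairing_growth T β hT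
    (inCone_letterAxis ((l :: L).getLast hne)) (l :: L) (inCone_letterAxis (letterInv l))
    (by rw [hll]; exact FreeGroup.isReduced_cons_cons.2 ⟨fun _ => rfl, hred⟩)
  have h₁ := abs_le.1 (abs_geodesicPairing_le hk hx (inCone_letterAxis _) hM)
  have h₂ := abs_le.1 (abs_geodesicPairing_le hm (inCone_letterAxis _) hy hM')
  linarith [h v, h₁.1, h₂.2]

theorem letterMat_mul_letterInv (l : Fin 2 × Bool) :
    letterMat l * letterMat (letterInv l) = 1 := by
  obtain ⟨i, b⟩ := l
  fin_cases i <;> cases b <;> ext p q <;> fin_cases p <;> fin_cases q <;>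
    norm_num [letterMat, letterInv, schottkyMat, schottkyInv, Matrix.mul_apply]

theorem letterMat_conj_letterTrans (l : Fin 2 × Bool) :
    letterMat l * letterTrans l * letterMat (letterInv l) = letterTrans l := by
  obtain ⟨i, b⟩ := l
  fin_cases i <;> cases b <;> ext p q <;> fin_cases p <;> fin_cases q <;>
    norm_num [letterMat, letterInv, schottkyMat, schottkyInv, Matrix.mul_apply, letterTrans,
      schottkyTrans]

theorem det_letterMat (l : Fin 2 × Bool) : (letterMat l).det = 1 := by
  obtain ⟨i, b⟩ := l
  fin_cases i <;> cases b <;> norm_num [letterMat, schottkyMat, schottkyInv, Matrix.det_fin_two]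

theorem trace_letterTrans (l : Fin 2 × Bool) : (letterTrans l).trace = 0 := by
  obtain ⟨i, b⟩ := l
  fin_cases i <;> cases b <;> norm_num [letterTrans, schottkyTrans, Matrix.trace_fin_two]

theorem mem_sl {n : ℕ} {X : Matrix (Fin n) (Fin n) ℝ} : X ∈ sl n ↔ X.trace = 0 := by
  simp [sl]

/-- Conjugation by an invertible matrix `g` with inverse `h`, on traceless matrices. -/
def slConj {n : ℕ} (g h : Matrix (Fin n) (Fin n) ℝ) (hgh : g * h = 1) : sl n ≃ₗ[ℝ] sl n where
  toFun X := ⟨g * X * h, by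
    rw [mem_sl, Matrix.trace_mul_cycle, mul_eq_one_comm.1 hgh, one_mul]; exact mem_sl.1 X.2⟩
  invFun X := ⟨h * X * g, by
    rw [mem_sl, Matrix.trace_mul_cycle, hgh, one_mul]; exact mem_sl.1 X.2⟩
  map_add' X Y := by ext1; simp [mul_add, add_mul]
  map_smul' c X := by ext1; simp
  left_inv X := by
    have hhg := mul_eq_one_comm.1 hgh
    ext1
    change h * (g * X * h) * g = X
    rw [mul_assoc g, ← mul_assoc h, hhg, one_mul, mul_assoc, hhg, mul_one]
  right_inv X := by
    ext1
    change g * (h * X * g) * h = X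
    rw [mul_assoc h, ← mul_assoc g, hgh, one_mul, mul_assoc, hgh, mul_one]

/-- The affine map `X ↦ g X h + U` of traceless matrices, where `h` is the inverse of `g`. -/
def slAffine {n : ℕ} (g h : Matrix (Fin n) (Fin n) ℝ) (hgh : g * h = 1) (U : sl n) : AffSl n :=
  (slConj g h hgh).toAffineEquiv.trans (AffineEquiv.constVAdd ℝ (sl n) U)

theorem slAffine_apply {n : ℕ} (g h : Matrix (Fin n) (Fin n) ℝ) (hgh : g * h = 1) (U X : sl n) :
    (slAffine g h hgh U X : Matrix (Fin n) (Fin n) ℝ) = g * X * h + U := by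
  change (U : Matrix (Fin n) (Fin n) ℝ) + g * X * h = _
  rw [add_comm]

/-- Affine transformations whose linear part is in the image of the adjoint representation of
`SL(n,ℝ)`. -/
def adjointAffine (n : ℕ) : Subgroup (AffSl n) where
  carrier := {γ | ∃ g : Matrix (Fin n) (Fin n) ℝ, g.det = 1 ∧
    ∃ Y : Matrix (Fin n) (Fin n) ℝ, Y.trace = 0 ∧
      ∀ X : sl n, (γ X : Matrix (Fin n) (Fin n) ℝ) = g * X * g⁻¹ + Y}
  one_mem' := ⟨1, by simp, 0, by simp, fun X => by simp⟩
  mul_mem' := by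
    rintro γ δ ⟨g, hg, Y, hY, h⟩ ⟨g', hg', Y', hY', h'⟩
    have hgu : IsUnit g.det := by simp [hg]
    refine ⟨g * g', by simp [hg, hg'], g * Y' * g⁻¹ + Y, ?_, fun X => ?_⟩
    · rw [Matrix.trace_add, Matrix.trace_mul_cycle, Matrix.nonsing_inv_mul _ hgu, one_mul, hY, hY',
        add_zero]
    · rw [AffineEquiv.mul_def, AffineEquiv.trans_apply, h, h', Matrix.mul_inv_rev]
      noncomm_ring
  inv_mem' := by
    rintro γ ⟨g, hg, Y, hY, h⟩
    have hgu : IsUnit g.det := by simp [hg]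
    refine ⟨g⁻¹, by simp [Matrix.det_nonsing_inv, hg], -(g⁻¹ * Y * g), ?_, fun X => ?_⟩
    · rw [Matrix.trace_neg, Matrix.trace_mul_cycle, Matrix.mul_nonsing_inv _ hgu, one_mul, hY,
        neg_zero]
    · have hX := h (γ⁻¹ X)
      rw [show γ (γ⁻¹ X) = X from γ.apply_symm_apply X] at hX
      rw [hX, Matrix.nonsing_inv_nonsing_inv _ hgu, mul_add, add_mul, mul_assoc g,
        ← mul_assoc g⁻¹, Matrix.nonsing_inv_mul _ hgu, one_mul, mul_assoc _ g⁻¹,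
        Matrix.nonsing_inv_mul _ hgu, mul_one, add_neg_cancel_right]

/-- The block diagonal matrix with blocks `A` and `D`, reindexed by `Fin n`. -/
def blockDiag {n k : ℕ} (e : Fin 2 ⊕ Fin k ≃ Fin n) (A : Matrix (Fin 2) (Fin 2) ℝ)
    (D : Matrix (Fin k) (Fin k) ℝ) : Matrix (Fin n) (Fin n) ℝ :=
  Matrix.reindex e e (Matrix.fromBlocks A 0 0 D)

/-- The upper left block of a matrix. -/
def upperBlock {n k : ℕ} (e : Fin 2 ⊕ Fin k ≃ Fin n) (X : Matrix (Fin n) (Fin n) ℝ) :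
    Matrix (Fin 2) (Fin 2) ℝ :=
  X.submatrix (e ∘ Sum.inl) (e ∘ Sum.inl)

section blocks

variable {n k : ℕ} (e : Fin 2 ⊕ Fin k ≃ Fin n)

theorem blockDiag_mul (A A' : Matrix (Fin 2) (Fin 2) ℝ) (D D' : Matrix (Fin k) (Fin k) ℝ) :
    blockDiag e A D * blockDiag e A' D' = blockDiag e (A * A') (D * D') := by
  simp [blockDiag, Matrix.submatrix_mul_equiv, Matrix.fromBlocks_multiply]

theorem blockDiag_one : blockDiag e 1 1 = 1 := by
  simp [blockDiag]

theorem det_blockDiag (A : Matrix (Fin 2) (Fin 2) ℝ) (D : Matrix (Fin k) (Fin k) ℝ) :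
    (blockDiag e A D).det = A.det * D.det := by
  simp [blockDiag]

theorem trace_blockDiag (A : Matrix (Fin 2) (Fin 2) ℝ) (D : Matrix (Fin k) (Fin k) ℝ) :
    (blockDiag e A D).trace = A.trace + D.trace := by
  have h : (blockDiag e A D).trace = ∑ i, Matrix.fromBlocks A 0 0 D i i :=
    e.symm.sum_comp fun i => Matrix.fromBlocks A 0 0 D i i
  rw [h, Fintype.sum_sum_type]
  rfl

theorem upperBlock_conj (A A' U : Matrix (Fin 2) (Fin 2) ℝ) (D D' W : Matrix (Fin k) (Fin k) ℝ)
    (X : Matrix (Fin n) (Fin n) ℝ) :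
    upperBlock e (blockDiag e A D * X * blockDiag e A' D' + blockDiag e U W) =
      A * upperBlock e X * A' + U := by
  obtain ⟨Z, rfl⟩ := (Matrix.reindex e e).surjective X
  rw [← Matrix.fromBlocks_toBlocks Z]
  simp only [blockDiag, Matrix.reindex_apply, Matrix.submatrix_mul_equiv,
    Matrix.fromBlocks_multiply, upperBlock]
  ext i j
  simp [Matrix.mul_apply]

/-- The affine transformations of `sl(n,ℝ)` generating a free group acting properly. -/
def schottkyAffine (i : Fin 2) : AffSl n :=
  slAffine (blockDiag e (letterMat (i, true)) 1) (blockDiag e (letterMat (i, false)) 1)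
    (by rw [blockDiag_mul, one_mul]
        exact (congrArg (blockDiag e · 1) (letterMat_mul_letterInv (i, true))).trans
          (blockDiag_one e))
    ⟨blockDiag e (letterTrans (i, true)) 0, by
      rw [mem_sl, trace_blockDiag, trace_letterTrans, Matrix.trace_zero, add_zero]⟩

theorem schottkyAffine_mem (i : Fin 2) : schottkyAffine e i ∈ adjointAffine n := by
  refine ⟨blockDiag e (letterMat (i, true)) 1, ?_, blockDiag e (letterTrans (i, true)) 0, ?_,
    fun X => ?_⟩
  · rw [det_blockDiag, det_letterMat, Matrix.det_one, one_mul]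
  · rw [trace_blockDiag, trace_letterTrans, Matrix.trace_zero, add_zero]
  · rw [schottkyAffine, slAffine_apply]
    congr
    refine (Matrix.inv_eq_right_inv ?_).symm
    rw [blockDiag_mul, one_mul]
    exact (congrArg (blockDiag e · 1) (letterMat_mul_letterInv (i, true))).trans (blockDiag_one e)

/-- The affine transformation attached to a letter of the free group. -/
def letterAffine (l : Fin 2 × Bool) : AffSl n :=
  cond l.2 (schottkyAffine e l.1) (schottkyAffine e l.1)⁻¹

theorem upperBlock_letterAffine (l : Fin 2 × Bool) (X : sl n) :
    upperBlock e (letterAffine e l X : sl n) =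
      letterMat l * upperBlock e X * letterMat (letterInv l) + letterTrans l := by
  obtain ⟨i, b⟩ := l
  have h : ∀ X : sl n, upperBlock e (schottkyAffine e i X : sl n) =
      letterMat (i, true) * upperBlock e X * letterMat (i, false) + letterTrans (i, true) :=
    fun X => by rw [schottkyAffine, slAffine_apply, upperBlock_conj]
  cases b with
  | true => exact h X
  | false =>
    have hX := h ((schottkyAffine e i)⁻¹ X)
    rw [show schottkyAffine e i ((schottkyAffine e i)⁻¹ X) = X from
      (schottkyAffine e i).apply_symm_apply X] at hX
    change upperBlock e ((schottkyAffine e i)⁻¹ X : sl n) =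
      letterMat (i, false) * upperBlock e X * letterMat (i, true) + letterTrans (i, false)
    have h₁ : letterMat (i, false) * letterMat (i, true) = 1 :=
      letterMat_mul_letterInv (i, false)
    have h₂ : letterMat (i, false) * letterTrans (i, false) * letterMat (i, true) =
      letterTrans (i, false) := letterMat_conj_letterTrans (i, false)
    have h₃ : letterTrans (i, true) = -letterTrans (i, false) := by simp [letterTrans]
    rw [hX, h₃, mul_add, add_mul, mul_neg, neg_mul, h₂, neg_add_cancel_right,
      mul_assoc (letterMat (i, true)), ← mul_assoc (letterMat (i, false)), h₁, one_mul,
      mul_assoc, h₁, mul_one]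

theorem lift_schottkyAffine_apply (w : FreeGroup (Fin 2)) (X : sl n) :
    FreeGroup.lift (schottkyAffine e) w X =
      w.toWord.foldr (fun l Y => letterAffine e l Y) X := by
  conv_lhs => rw [← FreeGroup.mk_toWord (x := w), FreeGroup.lift_mk]
  induction w.toWord with
  | nil => rfl
  | cons l L ih =>
    rw [List.map_cons, List.prod_cons, List.foldr_cons, ← ih]
    rfl

theorem length_toWord_le_s8 {w : FreeGroup (Fin 2)} {X : sl n} {M M' : ℝ}
    (hM : ∀ i j, |upperBlock e X i j| ≤ M)
    (hM' : ∀ i j, |upperBlock e (FreeGroup.lift (schottkyAffine e) w X : sl n) i j| ≤ M') :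
    (w.toWord.length : ℝ) ≤ 180 * (M + M') := by
  rw [lift_schottkyAffine_apply] at hM'
  exact length_le_of_isReduced (fun l Y => letterAffine e l Y) (fun Y : sl n => upperBlock e Y)
    (upperBlock_letterAffine e) FreeGroup.isReduced_toWord hM hM'

theorem lift_schottkyAffine_injective :
    Function.Injective (FreeGroup.lift (schottkyAffine e)) := by
  rw [injective_iff_map_eq_one]
  intro w hw
  have h : (w.toWord.length : ℝ) ≤ 180 * (0 + 0) :=
    length_toWord_le_s8 e (X := 0) (by simp [upperBlock]) (by simp [hw, upperBlock])
  rw [← FreeGroup.toWord_eq_nil_iff, ← List.length_eq_zero_iff, ← Nat.le_zero]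
  have : (w.toWord.length : ℝ) ≤ 0 := by linarith
  exact_mod_cast this

theorem exists_abs_upperBlock_le {K : Set (sl n)} (hK : IsCompact K) :
    ∃ M : ℝ, ∀ X ∈ K, ∀ i j, |upperBlock e X i j| ≤ M := by
  have hc : Continuous fun X : sl n => ∑ i, ∑ j, |upperBlock e X i j| := by
    simp only [upperBlock, Matrix.submatrix_apply]
    exact continuous_finsetSum _ fun i _ => continuous_finsetSum _ fun j _ =>
      (continuous_subtype_val.matrix_elem _ _).abs
  obtain ⟨M, hM⟩ := hK.bddAbove_image hc.continuousOn
  refine ⟨M, fun X hX i j => le_trans ?_ (hM ⟨X, hX, rfl⟩)⟩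
  exact (Finset.single_le_sum (f := fun j => |upperBlock e X i j|) (fun _ _ => abs_nonneg _)
    (Finset.mem_univ j)).trans (Finset.single_le_sum (f := fun i => ∑ j, |upperBlock e X i j|)
    (fun _ _ => Finset.sum_nonneg fun _ _ => abs_nonneg _) (Finset.mem_univ i))

theorem properlyDisc_range_lift :
    ProperlyDisc (fun (γ : (FreeGroup.lift (schottkyAffine e)).range) (X : sl n) =>
      (γ : AffSl n) X) := by
  intro K L hK hL
  obtain ⟨M, hM⟩ := exists_abs_upperBlock_le e hK
  obtain ⟨M', hM'⟩ := exists_abs_upperBlock_le e hL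
  have hfin : {w : FreeGroup (Fin 2) | w.toWord.length ≤ ⌊180 * (M + M')⌋₊}.Finite :=
    (List.finite_length_le (Fin 2 × Bool) _).preimage FreeGroup.toWord_injective.injOn
  refine (hfin.image (FreeGroup.lift (schottkyAffine e)).rangeRestrict).subset ?_
  rintro ⟨_, w, rfl⟩ ⟨_, ⟨X, hX, rfl⟩, hXL⟩
  exact ⟨w, Nat.le_floor (length_toWord_le_s8 e (hM X hX) (hM' _ hXL)), rfl⟩

end blocks

/-- (Smilga; instances for `G = SL(n,ℝ)`.) For every `n ≥ 2` there is a group of affine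
transformations of `sl(n,ℝ)`, each of the form `X ↦ g X g⁻¹ + Y` with `det g = 1` and
`Y` traceless, which is free of rank 2 and acts properly discontinuously on `sl(n,ℝ)`. -/
theorem smilga_adjoint_sl_not_milnor (n : ℕ) (hn : 2 ≤ n) :
    ∃ Γ : Subgroup (AffSl n),
      (∀ γ ∈ Γ, ∃ g : Matrix (Fin n) (Fin n) ℝ, g.det = 1 ∧
        ∃ Y : Matrix (Fin n) (Fin n) ℝ, Y.trace = 0 ∧
          ∀ X : sl n, (((γ : AffSl n) X : sl n) : Matrix (Fin n) (Fin n) ℝ)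
            = g * (X : Matrix (Fin n) (Fin n) ℝ) * g⁻¹ + Y) ∧
      Nonempty (Γ ≃* FreeGroup (Fin 2)) ∧
      ProperlyDisc (fun (γ : Γ) (X : sl n) => (γ : AffSl n) X) := by
  obtain ⟨k, rfl⟩ := Nat.exists_eq_add_of_le hn
  let e : Fin 2 ⊕ Fin k ≃ Fin (2 + k) := finSumFinEquiv
  refine ⟨(FreeGroup.lift (schottkyAffine e)).range, fun γ hγ => ?_,
    ⟨(MonoidHom.ofInjective (lift_schottkyAffine_injective e)).symm⟩, properlyDisc_range_lift e⟩
  exact FreeGroup.range_lift_le (s := adjointAffine (2 + k))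
    (Set.range_subset_iff.2 (schottkyAffine_mem e)) hγ
end
end
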